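/- arXiv:2508.12348 — 2 statements merged into one kernel-verified Lean document; each statement's English description precedes it below -/
import Mathlib

section
/- Let X be an S-concave (S ≥ 1), (C,D)-locally semi-convex, Busemann concave complete geodesic space whose Hausdorff dimension equals n ∈ ℕ. Then for every δ with 0 < δ < 1/2, the set X \ A(n,δ) of points that are not (n,δ)-strained has zero n-dimensional Hausdorff measure: μH[n](X \ A(n,δ)) = 0. -/
open Set Metric MeasureTheory Filter Topology

noncomputable section

variable {X : Type*} [MetricSpace X]

/-- A constant-speed geodesic parametrized on `[0,1]`. -/
def IsConstSpeedGeodesic (γ : ℝ → X) : Prop :=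
  ∀ s ∈ Set.Icc (0:ℝ) 1, ∀ t ∈ Set.Icc (0:ℝ) 1,
    dist (γ s) (γ t) = |s - t| * dist (γ 0) (γ 1)

/-- A unit-speed geodesic parametrized on `[a,b]`. -/
def IsUnitSpeedGeodesicOn (ξ : ℝ → X) (a b : ℝ) : Prop :=
  ∀ s ∈ Set.Icc a b, ∀ t ∈ Set.Icc a b, dist (ξ s) (ξ t) = |s - t|

/-- A geodesic space: any two points are joined by a constant-speed geodesic. -/
def IsGeodesicSpace (X : Type*) [MetricSpace X] : Prop :=
  ∀ x y : X, ∃ γ : ℝ → X, IsConstSpeedGeodesic γ ∧ γ 0 = x ∧ γ 1 = y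

/-- `S`-concavity of the squared distance functions. -/
def SConcave (X : Type*) [MetricSpace X] (S : ℝ) : Prop :=
  ∀ (p : X) (γ : ℝ → X), IsConstSpeedGeodesic γ → ∀ t ∈ Set.Icc (0:ℝ) 1,
    (1 - t) * dist p (γ 0) ^ 2 + t * dist p (γ 1) ^ 2
      - S * t * (1 - t) * dist (γ 0) (γ 1) ^ 2 ≤ dist p (γ t) ^ 2

/-- `(C,D)`-local semi-convexity of the squared distance functions. -/
def LocSemiConvex (X : Type*) [MetricSpace X] (C D : ℝ) : Prop :=
  ∀ (p : X) (γ : ℝ → X), IsConstSpeedGeodesic γ →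
    (∀ t ∈ Set.Icc (0:ℝ) 1, dist p (γ t) < D) →
    ∀ t ∈ Set.Icc (0:ℝ) 1,
      dist p (γ t) ^ 2 ≤ (1 - t) * dist p (γ 0) ^ 2 + t * dist p (γ 1) ^ 2
        + C * t * (1 - t) * dist (γ 0) (γ 1) ^ 2

/-- Busemann concavity: `t ↦ dist (γ t) (η t) / t` is non-increasing for geodesics
with a common starting point. -/
def BusemannConcave (X : Type*) [MetricSpace X] : Prop :=
  ∀ γ η : ℝ → X, IsConstSpeedGeodesic γ → IsConstSpeedGeodesic η → γ 0 = η 0 →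
    ∀ s t : ℝ, 0 < s → s ≤ t → t ≤ 1 →
      dist (γ t) (η t) / t ≤ dist (γ s) (η s) / s

/-- The Euclidean comparison angle `∠̃(p, x, q)` at the vertex `x`. -/
def compAngle (p x q : X) : ℝ :=
  Real.arccos ((dist x p ^ 2 + dist x q ^ 2 - dist p q ^ 2) / (2 * dist x p * dist x q))

/-- `p` is a `(1,δ)`-strainer at `x` with opposite strainer `q`. -/
def IsOneStrainer (S δ : ℝ) (x p q : X) : Prop :=
  p ≠ x ∧ q ≠ x ∧ Real.pi - δ < compAngle p x q ∧
    Real.arccos (1 - S * dist q x / (2 * dist p x)) < δ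

/-- The tuple `p` is a `(k,δ)`-strainer at `x` with opposite strainer `q`. -/
def IsStrainer (S C D δ : ℝ) (x : X) {k : ℕ} (p q : Fin k → X) : Prop :=
  (∀ j, IsOneStrainer S δ x (p j) (q j)) ∧
  (∀ j : Fin k, (j : ℕ) = 0 → dist (p j) x < D) ∧
  ∀ i j : Fin k, i < j →
    Real.arccos (1 - (S + C) * dist (p j) x / (2 * dist (p i) x)) < δ ∧
    |compAngle (p i) x (p j) - Real.pi / 2| < δ ∧
    |compAngle (p i) x (q j) - Real.pi / 2| < δ

/-- The set `A(k,δ)` of `(k,δ)`-strained points. -/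
def strainedPoints (X : Type*) [MetricSpace X] (S C D δ : ℝ) (k : ℕ) : Set X :=
  {x : X | ∃ p q : Fin k → X, IsStrainer S C D δ x p q}

/-- The constant `δ_k = k⁻¹ 2^{-2k-1}`. -/
def strainerDelta (k : ℕ) : ℝ := ((k : ℝ) * 2 ^ (2 * k + 1))⁻¹

/-- The `ℓ¹` distance on `Fin k → ℝ`. -/
def l1dist {k : ℕ} (u v : Fin k → ℝ) : ℝ := ∑ i, |u i - v i|

/-- `F` is an `ε`-open map on `U`, where the target carries the distance `dY`. -/
def IsEpsOpenOn {Y : Type*} (F : X → Y) (dY : Y → Y → ℝ) (U : Set X) (ε : ℝ) : Prop :=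
  ∀ x ∈ U, ∃ r > 0, Metric.closedBall x (ε⁻¹ * r) ⊆ U ∧
    IsComplete (Metric.closedBall x (ε⁻¹ * r)) ∧
    ∀ v : Y, dY (F x) v < r → ∃ y ∈ U, F y = v ∧ ε * dist x y ≤ dY (F x) v

/-- `N` is a norm on a real vector space. -/
def IsNormFn {E : Type*} [AddCommGroup E] [Module ℝ E] (N : E → ℝ) : Prop :=
  (∀ u, 0 ≤ N u) ∧ (∀ u, N u = 0 ↔ u = 0) ∧
  (∀ (a : ℝ) (u : E), N (a • u) = |a| * N u) ∧ ∀ u v, N (u + v) ≤ N u + N v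

/-- `F` is an `ε`-isometry between pointed metric spaces, the metrics being
given by the explicit distance functions `dX` and `dY`. -/
def IsEpsIsometry {Y : Type*} (dX : X → X → ℝ) (x : X) (dY : Y → Y → ℝ) (y : Y)
    (ε : ℝ) (F : X → Y) : Prop :=
  F x = y ∧
  (∀ z z' : X, dX x z < 1 / ε → dX x z' < 1 / ε →
    |dX z z' - dY (F z) (F z')| < ε) ∧
  ∀ r : ℝ, r < 1 / ε → ∀ w : Y, dY y w < r - ε →
    ∃ z : X, dX x z < r ∧ dY w (F z) ≤ ε

/-- The metric space `X` is doubling with constant `N`. -/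
def MetricDoubling (X : Type*) [MetricSpace X] (N : ℕ) : Prop :=
  ∀ (x : X) (r : ℝ), 0 < r → ∃ t : Finset X,
    (Metric.ball x r ⊆ ⋃ y ∈ t, Metric.ball y (r / 2)) ∧ t.card ≤ N

/-- Working version of a strainer. -/
def Good (η D : ℝ) {k : ℕ} (p q : Fin k → X) (x : X) : Prop :=
  (∀ i, 0 < dist (p i) x ∧ 0 < dist (q i) x ∧
    dist (p i) x + (1 - η) * dist (q i) x < dist (p i) (q i) ∧
    dist (q i) x < η * dist (p i) x ∧ dist (p i) x < D / 4) ∧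
  ∀ i j, i < j → dist (p j) x < η * dist (p i) x ∧
    |dist (p i) (p j) - dist (p i) x| < η * dist (p j) x ∧
    |dist (p i) (q j) - dist (p i) x| < η * dist (q j) x

lemma isOpen_good (η D : ℝ) {k : ℕ} (p q : Fin k → X) : IsOpen {x : X | Good η D p q x} := by
  have : {x : X | Good η D p q x} =
    (⋂ i, {x | 0 < dist (p i) x ∧ 0 < dist (q i) x ∧
    dist (p i) x + (1 - η) * dist (q i) x < dist (p i) (q i) ∧
    dist (q i) x < η * dist (p i) x ∧ dist (p i) x < D / 4}) ∩
    ⋂ i, ⋂ j, ⋂ (_ : i < j), {x | dist (p j) x < η * dist (p i) x ∧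
    |dist (p i) (p j) - dist (p i) x| < η * dist (p j) x ∧
    |dist (p i) (q j) - dist (p i) x| < η * dist (q j) x} := by
    ext x; simp [Good]
  rw [this]
  refine IsOpen.inter (isOpen_iInter_of_finite fun i => ?_)
    (isOpen_iInter_of_finite fun i => isOpen_iInter_of_finite fun j =>
      isOpen_iInter_of_finite fun _ => ?_)
  · refine IsOpen.and ?_ (IsOpen.and ?_ (IsOpen.and ?_ (IsOpen.and ?_ ?_))) <;>
      exact isOpen_lt (by fun_prop) (by fun_prop)
  · refine IsOpen.and ?_ (IsOpen.and ?_ ?_) <;>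
      exact isOpen_lt (by fun_prop) (by fun_prop)

lemma concat_geod (hgeo : IsGeodesicSpace X) {p x z : X} {t : ℝ} (ht0 : 0 < t) (ht1 : t < 1)
    (h1 : dist p x = t * dist p z) (h2 : dist x z = (1 - t) * dist p z) :
    ∃ γ : ℝ → X, IsConstSpeedGeodesic γ ∧ γ 0 = p ∧ γ 1 = z ∧ γ t = x := by
  obtain ⟨α, hα, hα0, hα1⟩ := hgeo p x
  obtain ⟨β, hβ, hβ0, hβ1⟩ := hgeo x z
  set L := dist p z with hL
  have hL0 : 0 ≤ L := dist_nonneg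
  have h1t : 0 < 1 - t := by linarith
  let γ : ℝ → X := fun s => if s ≤ t then α (s / t) else β ((s - t) / (1 - t))
  have g0 : γ 0 = p := by simp [γ, ht0.le, hα0]
  have g1 : γ 1 = z := by
    have : ¬ (1 ≤ t) := by linarith
    simp only [γ, this, if_false]
    rw [div_self h1t.ne', hβ1]
  have gt : γ t = x := by
    simp only [γ, le_refl, if_true]
    rw [div_self ht0.ne', hα1]
  have A : ∀ s s', 0 ≤ s → s ≤ s' → s' ≤ t → dist (γ s) (γ s') = (s' - s) * L := by
    intro s s' h0 hss hst
    have e1 : γ s = α (s / t) := by simp [γ, hss.trans hst]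
    have e2 : γ s' = α (s' / t) := by simp [γ, hst]
    rw [e1, e2, hα _ ⟨by positivity, by rw [div_le_one ht0]; linarith⟩ _
      ⟨div_nonneg (by linarith) ht0.le, by rw [div_le_one ht0]; linarith⟩, hα0, hα1, h1,
      ← sub_div, abs_div, abs_of_pos ht0, abs_of_nonpos (by linarith)]
    field_simp
    ring
  have B' : ∀ s, t ≤ s → γ s = β ((s - t) / (1 - t)) := by
    intro s hs
    rcases hs.eq_or_lt with h | h
    · subst h; rw [gt]; simp [hβ0]
    · simp [γ, not_le.2 h]
  have B : ∀ s s', t ≤ s → s ≤ s' → s' ≤ 1 → dist (γ s) (γ s') = (s' - s) * L := by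
    intro s s' h0 hss hst
    rw [B' s h0, B' s' (h0.trans hss), hβ _ ⟨div_nonneg (by linarith) h1t.le,
        by rw [div_le_one h1t]; linarith⟩ _
      ⟨div_nonneg (by linarith) h1t.le, by rw [div_le_one h1t]; linarith⟩, hβ0, hβ1, h2,
      ← sub_div, abs_div, abs_of_pos h1t, abs_of_nonpos (by linarith)]
    field_simp
    ring
  have key : ∀ s s', 0 ≤ s → s ≤ s' → s' ≤ 1 → dist (γ s) (γ s') = (s' - s) * L := by
    intro s s' h0 hss hs1
    rcases le_total s' t with h | h
    · exact A s s' h0 hss h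
    rcases le_total t s with h' | h'
    · exact B s s' h' hss hs1
    apply le_antisymm
    · calc _ ≤ dist (γ s) (γ t) + dist (γ t) (γ s') := dist_triangle _ _ _
        _ = _ := by rw [A s t h0 h' le_rfl, B t s' le_rfl h hs1]; ring
    · have := dist_triangle4 (γ 0) (γ s) (γ s') (γ 1)
      rw [A 0 s le_rfl h0 h', B s' 1 h hs1 le_rfl, g0, g1, ← hL] at this
      linarith
  refine ⟨γ, ?_, g0, g1, gt⟩
  intro s hs s' hs'
  rw [g0, g1, ← hL]
  rcases le_total s s' with h | h
  · rw [key s s' hs.1 h hs'.2, abs_of_nonpos (by linarith)]; ring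
  · rw [dist_comm, key s' s hs'.1 h hs.2, abs_of_nonneg (by linarith)]

lemma contract_lip (hgeo : IsGeodesicSpace X) (hbus : BusemannConcave X) {p x z x' z' : X} {t : ℝ}
    (ht0 : 0 < t) (ht1 : t < 1)
    (h1 : dist p x = t * dist p z) (h2 : dist x z = (1 - t) * dist p z)
    (h1' : dist p x' = t * dist p z') (h2' : dist x' z' = (1 - t) * dist p z') :
    dist z z' ≤ t⁻¹ * dist x x' := by
  obtain ⟨γ, hγ, a, b, c⟩ := concat_geod hgeo ht0 ht1 h1 h2
  obtain ⟨γ', hγ', a', b', c'⟩ := concat_geod hgeo ht0 ht1 h1' h2'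
  have := hbus γ γ' hγ hγ' (by rw [a, a']) t 1 ht0 ht1.le le_rfl
  rw [b, b', c, c'] at this
  rw [div_one] at this
  rw [inv_mul_eq_div]; exact this

/-- points lying at parameter `t` of a geodesic issuing from `p`. -/
def Wset (p : X) (t : ℝ) : Set X :=
  {x | ∃ z, dist p x = t * dist p z ∧ dist x z = (1 - t) * dist p z}

lemma isClosed_Wset [CompleteSpace X] (hgeo : IsGeodesicSpace X) (hbus : BusemannConcave X)
    (p : X) {t : ℝ} (ht0 : 0 < t) (ht1 : t < 1) : IsClosed (Wset p t) := by
  apply IsSeqClosed.isClosed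
  intro u x hu hx
  choose z hz1 hz2 using hu
  have hc : CauchySeq z := by
    have hcu := hx.cauchySeq
    rw [Metric.cauchySeq_iff] at hcu ⊢
    intro ε hε
    obtain ⟨N, hN⟩ := hcu (t * ε) (by positivity)
    refine ⟨N, fun m hm l hl => ?_⟩
    have := contract_lip hgeo hbus ht0 ht1 (hz1 m) (hz2 m) (hz1 l) (hz2 l)
    refine this.trans_lt ?_
    rw [inv_mul_lt_iff₀ ht0]
    exact hN m hm l hl
  obtain ⟨w, hw⟩ := cauchySeq_tendsto_of_complete hc
  refine ⟨w, ?_, ?_⟩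
  · refine tendsto_nhds_unique (tendsto_const_nhds.dist hx) ?_
    simp_rw [hz1]
    exact (tendsto_const_nhds.dist hw).const_mul t
  · refine tendsto_nhds_unique (hx.dist hw) ?_
    simp_rw [hz2]
    exact (tendsto_const_nhds.dist hw).const_mul (1 - t)

lemma antilip_measure {Y : Type*} [MetricSpace Y] [MeasurableSpace X] [BorelSpace X]
    [MeasurableSpace Y] [BorelSpace Y] (F : X → Y) (K : ℝ) (hK : 0 ≤ K) (u : Set X)
    (h : ∀ x ∈ u, ∀ y ∈ u, dist x y ≤ K * dist (F x) (F y)) (d : ℝ) (hd : 0 ≤ d) :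
    μH[d] u ≤ ENNReal.ofReal K ^ d * μH[d] (F '' u) := by
  classical
  rcases u.eq_empty_or_nonempty with rfl | ⟨x0, hx0⟩
  · simp
  have : Nonempty X := ⟨x0⟩
  have hinj : Set.InjOn F u := by
    intro x hx y hy hxy
    have := h x hx y hy
    rw [hxy, dist_self, mul_zero] at this
    exact dist_le_zero.1 this
  let g := Function.invFunOn F u
  have hg : ∀ x ∈ u, g (F x) = x := fun x hx => hinj.leftInvOn_invFunOn hx
  have himg : g '' (F '' u) = u := by
    rw [Set.image_image]
    ext y
    constructor
    · rintro ⟨x, hx, rfl⟩; simpa [hg x hx] using hx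
    · intro hy; exact ⟨y, hy, hg y hy⟩
  have hl : LipschitzOnWith (Real.toNNReal K) g (F '' u) := by
    apply LipschitzOnWith.of_dist_le_mul
    rintro _ ⟨x, hx, rfl⟩ _ ⟨y, hy, rfl⟩
    rw [hg x hx, hg y hy, Real.coe_toNNReal K hK]
    exact h x hx y hy
  have := hl.hausdorffMeasure_image_le hd
  rw [himg] at this
  exact this

/-- A weak form of the Ekeland variational principle. -/
lemma ekeland_weak [CompleteSpace X] (φ : X → ℝ) (hφ : Continuous φ) (h0 : ∀ x, 0 ≤ φ x) (c : ℝ)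
    (hc : 0 < c) (x0 : X) :
    ∃ x, φ x + c * dist x0 x ≤ φ x0 ∧ ∀ y, φ y + c * dist x y ≤ φ x → y = x := by
  let T : X → Set X := fun x => {y | φ y + c * dist x y ≤ φ x}
  have hbdd : ∀ x, BddBelow (φ '' T x) := fun x => ⟨0, by rintro _ ⟨y, _, rfl⟩; exact h0 y⟩
  have hself : ∀ x, x ∈ T x := fun x => by simp [T]
  have hstep : ∀ (m : ℕ) x, ∃ y ∈ T x, φ y < sInf (φ '' T x) + (1 / 2) ^ m := by
    intro m x
    obtain ⟨_, ⟨y, hy, rfl⟩, h⟩ := exists_lt_of_csInf_lt (s := φ '' T x) ⟨_, x, hself x, rfl⟩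
      (show sInf (φ '' T x) < sInf (φ '' T x) + (1 / 2) ^ m by
        have : (0:ℝ) < (1 / 2) ^ m := by positivity
        linarith)
    exact ⟨y, hy, h⟩
  choose f hfT hfs using hstep
  let u : ℕ → X := fun m => Nat.rec x0 (fun i y => f i y) m
  have hu : ∀ m, u (m + 1) = f m (u m) := fun m => rfl
  have htrans : ∀ x y z, y ∈ T x → z ∈ T y → z ∈ T x := by
    intro x y z hy hz
    simp only [T, mem_ofPred_eq] at *
    have := dist_triangle x y z
    nlinarith
  have hmono : ∀ m l, u (m + l) ∈ T (u m) := by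
    intro m l
    induction l with
    | zero => exact hself _
    | succ l ih => exact htrans _ _ _ ih (by rw [← add_assoc, hu]; exact hfT _ _)
  have hsmall : ∀ m y, y ∈ T (u (m + 1)) → c * dist (u (m + 1)) y ≤ (1 / 2) ^ m := by
    intro m y hy
    have h1 : y ∈ T (u m) := htrans _ _ _ (hmono m 1) hy
    have h2 : sInf (φ '' T (u m)) ≤ φ y := csInf_le (hbdd _) ⟨y, h1, rfl⟩
    have h3 := hfs m (u m)
    rw [← hu] at h3
    simp only [T, mem_ofPred_eq] at hy
    linarith
  have hcauchy : CauchySeq u := by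
    rw [Metric.cauchySeq_iff']
    intro ε hε
    obtain ⟨m, hm⟩ := exists_pow_lt_of_lt_one (show 0 < c * ε by positivity)
      (show (1 / 2 : ℝ) < 1 by norm_num)
    refine ⟨m + 1, fun l hl => ?_⟩
    obtain ⟨i, rfl⟩ := Nat.exists_eq_add_of_le hl
    have := hsmall m _ (hmono (m + 1) i)
    rw [dist_comm]
    exact lt_of_mul_lt_mul_left (this.trans_lt hm) hc.le
  obtain ⟨x, hx⟩ := cauchySeq_tendsto_of_complete hcauchy
  have hclosed : ∀ w, IsClosed (T w) := fun w => isClosed_le (by fun_prop) (by fun_prop)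
  have hxT : ∀ m, x ∈ T (u m) := fun m => (hclosed _).mem_of_tendsto hx (by
    filter_upwards [eventually_ge_atTop m] with l hl
    obtain ⟨i, rfl⟩ := Nat.exists_eq_add_of_le hl
    exact hmono m i)
  refine ⟨x, hxT 0, fun y hy => ?_⟩
  have h1 : ∀ m, c * dist (u (m + 1)) y ≤ (1 / 2) ^ m :=
    fun m => hsmall m y (htrans _ _ _ (hxT (m + 1)) hy)
  have h2 : Tendsto (fun m => c * dist (u (m + 1)) y) atTop (𝓝 (c * dist x y)) :=
    (((tendsto_add_atTop_iff_nat 1).2 hx).dist tendsto_const_nhds).const_mul c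
  have h3 : Tendsto (fun m : ℕ => (1 / 2 : ℝ) ^ m) atTop (𝓝 0) :=
    tendsto_pow_atTop_nhds_zero_of_lt_one (by norm_num) (by norm_num)
  have h4 : c * dist x y ≤ 0 := le_of_tendsto_of_tendsto' h2 h3 h1
  have h5 : dist x y ≤ 0 := by
    by_contra h
    push Not at h
    nlinarith [mul_pos hc h]
  exact (dist_le_zero.1 h5).symm

lemma arccos_lt_of {u δ : ℝ} (h0 : 0 < δ) (h1 : δ < 1 / 2) (hu : Real.cos δ < u) (hu1 : u ≤ 1) :
    Real.arccos u < δ := by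
  have h := Real.arccos_lt_arccos (Real.neg_one_le_cos δ) hu hu1
  rwa [Real.arccos_cos h0.le (by linarith [Real.pi_gt_three])] at h

lemma lt_arccos_of {u δ : ℝ} (h0 : 0 < δ) (h1 : δ < 1 / 2) (hu : u < - Real.cos δ) :
    Real.pi - δ < Real.arccos u := by
  rcases le_total u (-1) with h | h
  · rw [Real.arccos_of_le_neg_one h]; linarith
  have := arccos_lt_of h0 h1 (u := -u) (by linarith) (by linarith)
  rw [Real.arccos_neg] at this
  linarith

lemma abs_arccos_of {u δ : ℝ} (h0 : 0 < δ) (h1 : δ < 1 / 2) (hu : |u| < Real.sin δ) :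
    |Real.arccos u - Real.pi / 2| < δ := by
  have hs := Real.sin_le_one δ
  rw [abs_lt] at hu
  have e : Real.arcsin (Real.sin δ) = δ :=
    Real.arcsin_sin (by linarith [Real.pi_gt_three]) (by linarith [Real.pi_gt_three])
  have a1 : Real.arcsin u < δ := by
    have := Real.arcsin_lt_arcsin (by linarith) hu.2 hs
    rwa [e] at this
  have a2 : -δ < Real.arcsin u := by
    have := Real.arcsin_lt_arcsin (x := -Real.sin δ) (y := u) (by linarith) hu.1 (by linarith)
    rwa [Real.arcsin_neg, e] at this
  rw [Real.arccos_eq_pi_div_two_sub_arcsin, abs_lt]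
  constructor <;> linarith

lemma right_angle_aux {η P l d : ℝ} (hη : 0 < η) (hη1 : η ≤ 1 / 2) (hl : 0 < l) (hlP : l < η * P)
    (hd : |d - P| < η * l) :
    |(P ^ 2 + l ^ 2 - d ^ 2) / (2 * P * l)| ≤ 2 * η := by
  have hP : 0 < P := by
    by_contra h
    push Not at h
    nlinarith
  rw [abs_lt] at hd
  have h3 : l < P := by nlinarith
  rw [abs_div, abs_of_pos (show 0 < 2 * P * l by positivity), div_le_iff₀ (by positivity), abs_le]
  have h4 : η * l < P := by nlinarith
  have h5 : 0 < η * l := by positivity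
  have h6 : l * l < η * P * l := by nlinarith
  have h7 : η * l * (η * l) ≤ η * l * P := by nlinarith
  constructor
  · nlinarith
  · nlinarith

lemma good_isStrainer {S C D δ η : ℝ} (hS : 1 ≤ S) (hC : 0 ≤ C) (hD : 0 < D)
    (hδ0 : 0 < δ) (hδ : δ < 1 / 2) (hη : 0 < η) (hη1 : η ≤ 1 / 2)
    (h1 : 2 * η < 1 - Real.cos δ) (h2 : (S + C) * η < 2 * (1 - Real.cos δ))
    (h3 : 2 * η < Real.sin δ) {k : ℕ} {p q : Fin k → X} {x : X} (hG : Good η D p q x) :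
    IsStrainer S C D δ x p q := by
  obtain ⟨hA, hB⟩ := hG
  refine ⟨fun j => ?_, fun j _ => ?_, fun i j hij => ?_⟩
  · obtain ⟨a0, b0, hpq, hba, haD⟩ := hA j
    refine ⟨dist_pos.1 a0, dist_pos.1 b0, ?_, ?_⟩
    · apply lt_arccos_of hδ0 hδ
      rw [dist_comm x (p j), dist_comm x (q j)]
      set a := dist (p j) x
      set b := dist (q j) x
      set d := dist (p j) (q j)
      rw [div_lt_iff₀ (by positivity)]
      have hab : 0 < a * b := by positivity
      have : b < a := by nlinarith
      have e1 : 0 ≤ (1 - η) * b := mul_nonneg (by linarith) b0.le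
      have : (a + (1 - η) * b) ^ 2 ≤ d ^ 2 := by gcongr
      have h5 : b * b < a * b := by nlinarith
      have h6 : 2 * η * (b * b) ≤ 2 * η * (a * b) := by nlinarith
      have h7 : 0 ≤ η ^ 2 * (b * b) := by positivity
      nlinarith
    · apply arccos_lt_of hδ0 hδ
      · have : S * dist (q j) x / (2 * dist (p j) x) ≤ (S + C) * η / 2 := by
          rw [div_le_div_iff₀ (by positivity) (by norm_num)]
          have : S * dist (q j) x ≤ (S + C) * (η * dist (p j) x) := by
            apply mul_le_mul (by linarith) hba.le b0.le (by linarith)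
          linarith
        linarith
      · have : 0 ≤ S * dist (q j) x / (2 * dist (p j) x) := by positivity
        linarith
  · linarith [(hA j).2.2.2.2]
  · obtain ⟨c1, c2, c3⟩ := hB i j hij
    obtain ⟨a0, b0, -, -, -⟩ := hA i
    obtain ⟨a0', b0', -, hba', -⟩ := hA j
    have hqp : dist (q j) x < η * dist (p i) x := by nlinarith
    refine ⟨?_, ?_, ?_⟩
    · apply arccos_lt_of hδ0 hδ
      · have : (S + C) * dist (p j) x / (2 * dist (p i) x) ≤ (S + C) * η / 2 := by
          rw [div_le_div_iff₀ (by positivity) (by norm_num)]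
          have : (S + C) * dist (p j) x ≤ (S + C) * (η * dist (p i) x) := by
            apply mul_le_mul le_rfl c1.le a0'.le (by linarith)
          linarith
        linarith
      · have : 0 ≤ (S + C) * dist (p j) x / (2 * dist (p i) x) := by positivity
        linarith
    · apply abs_arccos_of hδ0 hδ
      rw [dist_comm x (p j), dist_comm x (p i)]
      exact (right_angle_aux hη hη1 a0' c1 c2).trans_lt h3
    · apply abs_arccos_of hδ0 hδ
      rw [dist_comm x (q j), dist_comm x (p i)]
      exact (right_angle_aux hη hη1 b0' hqp c3).trans_lt h3

lemma move_aux {S C D η : ℝ} (hS : 1 ≤ S) (hC : 0 ≤ C) (hη : 0 < η) (hη1 : η ≤ 1 / 2)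
    (hconc : SConcave X S) (hsemi : LocSemiConvex X C D) (p : X) (γ : ℝ → X)
    (hγ : IsConstSpeedGeodesic γ) (hP : 0 < dist p (γ 0)) (hPD : dist p (γ 0) < D / 4)
    (hl : dist (γ 0) (γ 1) ≤ η * dist p (γ 0))
    (hd : |dist p (γ 1) - dist p (γ 0)| ≤ η * dist (γ 0) (γ 1)) (t : ℝ)
    (ht : t ∈ Icc (0:ℝ) 1) :
    |dist p (γ t) - dist p (γ 0)| ≤ η * (3 + S + C) * (t * dist (γ 0) (γ 1)) := by
  have k1 := hconc p γ hγ t ht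
  have k2 := hsemi p γ hγ (fun u hu => by
    have e1 := hγ 0 ⟨le_rfl, zero_le_one⟩ u hu
    have e2 := dist_triangle p (γ 0) (γ u)
    have e3 : |0 - u| ≤ 1 := by rw [zero_sub, abs_neg, abs_of_nonneg hu.1]; exact hu.2
    have e4 : |0 - u| * dist (γ 0) (γ 1) ≤ 1 * dist (γ 0) (γ 1) :=
      mul_le_mul_of_nonneg_right e3 dist_nonneg
    nlinarith) t ht
  obtain ⟨ht0, ht1⟩ := ht
  have hf : 0 ≤ dist p (γ t) := dist_nonneg
  have hl0 : 0 ≤ dist (γ 0) (γ 1) := dist_nonneg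
  have hd0 : 0 ≤ dist p (γ 1) := dist_nonneg
  generalize dist p (γ t) = f at *
  generalize dist p (γ 0) = P at *
  generalize dist p (γ 1) = d at *
  generalize dist (γ 0) (γ 1) = l at *
  rw [abs_le] at hd ⊢
  have hlP : l ≤ P := by nlinarith
  have hηl : 0 ≤ η * l := by positivity
  have hηlP : η * l ≤ P := by nlinarith
  have q1 : d ^ 2 - P ^ 2 ≤ 3 * η * l * P := by nlinarith
  have q2 : -(3 * η * l * P) ≤ d ^ 2 - P ^ 2 := by nlinarith
  have q3 : l ^ 2 ≤ η * l * P := by nlinarith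
  have q4 : t * (1 - t) * l ^ 2 ≤ t * (η * l * P) := by
    have : t * (1 - t) ≤ t := by nlinarith
    have h2 : t * (1 - t) * l ^ 2 ≤ t * l ^ 2 := mul_le_mul_of_nonneg_right this (by positivity)
    have h3 : t * l ^ 2 ≤ t * (η * l * P) := mul_le_mul_of_nonneg_left q3 ht0
    linarith
  have r1 : t * (d ^ 2 - P ^ 2) ≤ t * (3 * η * l * P) := mul_le_mul_of_nonneg_left q1 ht0
  have r2 : t * (-(3 * η * l * P)) ≤ t * (d ^ 2 - P ^ 2) := mul_le_mul_of_nonneg_left q2 ht0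
  have r3 : S * (t * (1 - t) * l ^ 2) ≤ S * (t * (η * l * P)) :=
    mul_le_mul_of_nonneg_left q4 (by linarith)
  have r4 : C * (t * (1 - t) * l ^ 2) ≤ C * (t * (η * l * P)) :=
    mul_le_mul_of_nonneg_left q4 hC
  have hw : 0 ≤ t * (η * l * P) := by positivity
  set K := η * (3 + S + C) * (t * l) with hK
  have hK0 : 0 ≤ K := by positivity
  have hSw : 0 ≤ S * (t * (η * l * P)) := by positivity
  have hCw : 0 ≤ C * (t * (η * l * P)) := by positivity
  have s1 : f ^ 2 - P ^ 2 ≤ K * P := by rw [hK]; nlinarith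
  have s2 : -(K * P) ≤ f ^ 2 - P ^ 2 := by rw [hK]; nlinarith
  constructor
  · by_contra h
    push Not at h
    nlinarith
  · by_contra h
    push Not at h
    nlinarith

lemma ext_aux {S C ε m η P g h a b : ℝ} (hS : 1 ≤ S) (hC : 0 ≤ C) (hε : 0 < ε) (hε1 : ε ≤ 1)
    (hεm : ε ≤ m) (hεη : ε * (3 + (2 * S + 2 * C) / m) < η)
    (hP : m ≤ P) (hh : 0 ≤ h) (ha : 0 < a) (hb : 0 < b) (hba : b ≤ ε * a)
    (haε : a < ε) (hg : |g - P| ≤ ε * a)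
    (k1 : b * g ^ 2 + a * h ^ 2 - S * a * b * (a + b) ≤ P ^ 2 * (a + b))
    (k2 : P ^ 2 * (a + b) ≤ b * g ^ 2 + a * h ^ 2 + C * a * b * (a + b)) :
    |h - P| < η * b := by
  have hm : 0 < m := by linarith
  have hP0 : 0 < P := by linarith
  rw [abs_le] at hg
  have hba' : b ≤ a := by nlinarith
  have hea : 0 < ε * a := by positivity
  have heaP : ε * a ≤ P := by nlinarith
  have q1 : P ^ 2 - g ^ 2 ≤ 3 * P * (ε * a) := by nlinarith
  have q2 : -(3 * P * (ε * a)) ≤ P ^ 2 - g ^ 2 := by nlinarith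
  have r1 := mul_le_mul_of_nonneg_left q1 hb.le
  have r2 := mul_le_mul_of_nonneg_left q2 hb.le
  have hab : 0 < a * b := by positivity
  have w : a + b ≤ 2 * ε := by linarith
  have w1 : S * (a * b) * (a + b) ≤ S * (a * b) * (2 * ε) :=
    mul_le_mul_of_nonneg_left w (by positivity)
  have w2 : C * (a * b) * (a + b) ≤ C * (a * b) * (2 * ε) :=
    mul_le_mul_of_nonneg_left w (by positivity)
  have s1 : a * (h ^ 2 - P ^ 2) ≤ a * (b * ε * (3 * P + 2 * S)) := by nlinarith
  have s2 : a * (-(b * ε * (3 * P + 2 * C))) ≤ a * (h ^ 2 - P ^ 2) := by nlinarith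
  have s1' := le_of_mul_le_mul_left s1 ha
  have s2' := le_of_mul_le_mul_left s2 ha
  have hbe : 0 < b * ε := by positivity
  have key : b * ε * (3 * P + (2 * S + 2 * C)) < η * b * P := by
    have e1 : (2 * S + 2 * C) ≤ (2 * S + 2 * C) / m * P := by
      rw [div_mul_eq_mul_div, le_div_iff₀ hm]
      exact mul_le_mul_of_nonneg_left hP (by linarith)
    have e2 : b * ε * (3 * P + (2 * S + 2 * C)) ≤ b * ε * (3 * P + (2 * S + 2 * C) / m * P) :=
      mul_le_mul_of_nonneg_left (by linarith) hbe.le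
    have e3 := mul_lt_mul_of_pos_right hεη (show 0 < b * P by positivity)
    nlinarith
  have n1 : b * ε * (3 * P + 2 * S) ≤ b * ε * (3 * P + (2 * S + 2 * C)) :=
    mul_le_mul_of_nonneg_left (by linarith) hbe.le
  have n2 : b * ε * (3 * P + 2 * C) ≤ b * ε * (3 * P + (2 * S + 2 * C)) :=
    mul_le_mul_of_nonneg_left (by linarith) hbe.le
  have t1 : h ^ 2 - P ^ 2 < η * b * P := by linarith
  have t2 : -(η * b * P) < h ^ 2 - P ^ 2 := by linarith
  have hη : 0 < η * b := by
    have : 0 < η := lt_of_le_of_lt (by positivity) hεη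
    positivity
  rw [abs_lt]
  constructor
  · by_contra hc
    push Not at hc
    nlinarith
  · by_contra hc
    push Not at hc
    nlinarith

lemma extend_good {S C D η : ℝ} (hS : 1 ≤ S) (hC : 0 ≤ C) (hD : 0 < D) (hη : 0 < η)
    (hη1 : η ≤ 1 / 2) (hgeo : IsGeodesicSpace X)
    (hconc : SConcave X S) (hsemi : LocSemiConvex X C D) {k : ℕ} {p q : Fin k → X} {x0 : X}
    (hG : Good η D p q x0) :
    ∃ ε > 0, ε ≤ 1 ∧ ∀ x ∈ ball x0 ε, ∀ y z, y ≠ x → z ≠ x → dist y x + dist x z = dist y z →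
      dist x z ≤ ε * dist y x → dist y x < ε →
      (∀ i, |dist (p i) y - dist (p i) x| ≤ ε * dist y x) →
      Good η D (Fin.snoc p y : Fin (k + 1) → X) (Fin.snoc q z) x := by
  have hm : ∃ m > (0:ℝ), ∀ i, 2 * m ≤ dist (p i) x0 := by
    have h : ∀ᶠ m in 𝓝[>] (0:ℝ), ∀ i, 2 * m ≤ dist (p i) x0 := by
      rw [eventually_all]
      intro i
      have h0 := (hG.1 i).1
      filter_upwards [Ioo_mem_nhdsGT (show 0 < dist (p i) x0 / 2 by linarith)] with m hm
      linarith [hm.2]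
    obtain ⟨m, h1, h2⟩ := (h.and self_mem_nhdsWithin).exists
    exact ⟨m, h2, h1⟩
  obtain ⟨m, hm0, hm⟩ := hm
  obtain ⟨r, hr, hball⟩ := Metric.isOpen_iff.1 (isOpen_good η D p q) x0 hG
  have hK : 0 < 3 + (2 * S + 2 * C) / m := by positivity
  have hε : ∃ ε > (0:ℝ), ε ≤ 1 ∧ ε ≤ m ∧ ε ≤ r ∧ ε ≤ D / 8 ∧ ε ≤ η / 2 ∧ ε ≤ η * m ∧
      ε * (3 + (2 * S + 2 * C) / m) < η := by
    have h : ∀ᶠ ε in 𝓝[>] (0:ℝ), ε ≤ 1 ∧ ε ≤ m ∧ ε ≤ r ∧ ε ≤ D / 8 ∧ ε ≤ η / 2 ∧ ε ≤ η * m ∧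
      ε * (3 + (2 * S + 2 * C) / m) < η := by
      have g : ∀ c : ℝ, 0 < c → ∀ᶠ ε in 𝓝[>] (0:ℝ), ε < c := fun c hc => by
        filter_upwards [Ioo_mem_nhdsGT hc] with m hm using hm.2
      filter_upwards [g 1 one_pos, g m hm0, g r hr, g (D / 8) (by positivity),
        g (η / 2) (by positivity), g (η * m) (by positivity),
        g (η / (3 + (2 * S + 2 * C) / m)) (by positivity)] with ε h1 h2 h3 h4 h5 h6 h7
      exact ⟨h1.le, h2.le, h3.le, h4.le, h5.le, h6.le, (lt_div_iff₀ hK).1 h7⟩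
    obtain ⟨ε, h1, h2⟩ := (h.and self_mem_nhdsWithin).exists
    exact ⟨ε, h2, h1⟩
  obtain ⟨ε, hε0, e1, e2, e3, e4, e5, e6, e7⟩ := hε
  refine ⟨ε, hε0, e1, ?_⟩
  intro x hx y z hyx hzx hyz hxz hyε hf
  have hGx : Good η D p q x := hball (ball_subset_ball e3 hx)
  have ha : 0 < dist y x := dist_pos.2 hyx
  have hb : 0 < dist x z := dist_pos.2 (Ne.symm hzx)
  have hP : ∀ i, m ≤ dist (p i) x := fun i => by
    have := dist_triangle (p i) x x0
    rw [mem_ball] at hx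
    linarith [hm i]
  have h7 : ∀ i, |dist (p i) z - dist (p i) x| < η * dist x z := by
    intro i
    have hL : 0 < dist y z := by linarith
    set L := dist y z with hLdef
    obtain ⟨t, htdef⟩ : ∃ t, t = dist y x / L := ⟨_, rfl⟩
    have ht0 : 0 < t := by rw [htdef]; positivity
    have ht1 : t < 1 := by rw [htdef, div_lt_one hL]; linarith
    have hta : t * L = dist y x := by rw [htdef]; field_simp
    have htb : (1 - t) * L = dist x z := by rw [sub_mul, hta]; linarith
    obtain ⟨γ, hγ, g0, g1, gt⟩ := concat_geod hgeo (p := y) (x := x) (z := z) ht0 ht1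
      hta.symm htb.symm
    have ht : t ∈ Icc (0:ℝ) 1 := ⟨ht0.le, ht1.le⟩
    have c1 := hconc (p i) γ hγ _ ht
    have hba : dist x z ≤ dist y x := by nlinarith
    have c2 := hsemi (p i) γ hγ (fun u hu => by
      have h1 := hγ _ ht u hu
      rw [gt, g0, g1, ← hLdef] at h1
      have h2 := dist_triangle (p i) x (γ u)
      have h3 : |t - u| ≤ 1 := by
        rw [abs_le]; constructor <;> linarith [hu.1, hu.2]
      have h4 : |t - u| * L ≤ 1 * L := mul_le_mul_of_nonneg_right h3 hL.le
      have h5 := (hGx.1 i).2.2.2.2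
      linarith) _ ht
    rw [gt, g0, g1, ← hLdef] at c1 c2
    refine ext_aux hS hC hε0 e1 e2 e7 (hP i) dist_nonneg ha hb hxz hyε (hf i) ?_ ?_
    · have := mul_le_mul_of_nonneg_right c1 hL.le
      rw [hyz, ← hta, ← htb]
      linarith
    · have := mul_le_mul_of_nonneg_right c2 hL.le
      rw [hyz, ← hta, ← htb]
      linarith
  refine ⟨fun i => ?_, fun i j hij => ?_⟩
  · induction i using Fin.lastCases with
    | last =>
      simp only [Fin.snoc_last]
      refine ⟨ha, by rwa [dist_comm], ?_, ?_, by linarith⟩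
      · rw [← hyz, dist_comm z x]; nlinarith
      · rw [dist_comm z x]; nlinarith
    | cast i => simp only [Fin.snoc_castSucc]; exact hGx.1 i
  · induction j using Fin.lastCases with
    | last =>
      induction i using Fin.lastCases with
      | last => exact absurd hij (lt_irrefl _)
      | cast i =>
        simp only [Fin.snoc_last, Fin.snoc_castSucc]
        refine ⟨?_, ?_, ?_⟩
        · have := hP i
          nlinarith
        · have := hf i
          nlinarith
        · rw [dist_comm z x]; exact h7 i
    | cast j =>
      induction i using Fin.lastCases with
      | last => exact absurd hij (not_lt.2 (Fin.castSucc_lt_last j).le)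
      | cast i =>
        simp only [Fin.snoc_castSucc]
        exact hGx.2 i j (Fin.castSucc_lt_castSucc_iff.1 hij)

lemma step_aux {S C D η : ℝ} (hS : 1 ≤ S) (hC : 0 ≤ C) (hη : 0 < η)
    (hη1 : η ≤ 1 / 2) (hη2 : (2 + S) * η ≤ 1 / 2) (hgeo : IsGeodesicSpace X)
    (hconc : SConcave X S) (hsemi : LocSemiConvex X C D) {k : ℕ} {p q : Fin k → X} {x : X}
    (hG : Good η D p q x) (v : Fin k → ℝ) (i : Fin k) (hi : dist (p i) x ≠ v i) :
    ∃ y, 0 < dist x y ∧ |dist (p i) y - v i| ≤ |dist (p i) x - v i| - dist x y / 2 ∧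
      ∀ j < i, |dist (p j) y - dist (p j) x| ≤ η * (3 + S + C) * dist x y := by
  obtain ⟨a0, b0, hpq, hba, haD⟩ := hG.1 i
  rcases lt_or_gt_of_ne hi with h | h
  · -- move towards `q i`
    obtain ⟨γ, hγ, g0, g1⟩ := hgeo x (q i)
    have hb0 : 0 < dist x (q i) := by rwa [dist_comm]
    have hl : dist (q i) x = dist x (q i) := dist_comm _ _
    set b := dist x (q i) with hbdef
    set a := dist (p i) x with hadef
    set s := min b (v i - a) with hs
    have hs0 : 0 < s := lt_min hb0 (by linarith)
    have hsb : s ≤ b := min_le_left _ _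
    have hsv : s ≤ v i - a := min_le_right _ _
    have ht : s / b ∈ Icc (0:ℝ) 1 := ⟨by positivity, by rwa [div_le_one hb0]⟩
    have hxy : dist x (γ (s / b)) = s := by
      have := hγ 0 ⟨le_rfl, zero_le_one⟩ _ ht
      rw [g0, g1, zero_sub, abs_neg, abs_of_nonneg ht.1, ← hbdef, div_mul_cancel₀ _ hb0.ne'] at this
      exact this
    refine ⟨γ (s / b), by rwa [hxy], ?_, fun j hj => ?_⟩
    · have c1 := hconc (p i) γ hγ _ ht
      rw [g0, g1, ← hbdef, ← hadef] at c1
      rw [hl] at hpq hba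
      have tri := dist_triangle (p i) x (γ (s / b))
      rw [hxy, ← hadef] at tri
      set f := dist (p i) (γ (s / b)) with hf
      have hf0 : 0 ≤ f := dist_nonneg
      set d := dist (p i) (q i)
      have hd : a ^ 2 + 2 * (1 - η) * a * b ≤ d ^ 2 := by
        have e1 : 0 ≤ (1 - η) * b := mul_nonneg (by linarith) hb0.le
        have : (a + (1 - η) * b) ^ 2 ≤ d ^ 2 := by gcongr
        nlinarith
      have c2 : s * (2 * (1 - η) * a - S * b) ≤ f ^ 2 - a ^ 2 := by
        set t := s / b with htdef
        have hst : s = t * b := by rw [htdef]; field_simp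
        have e1 := mul_le_mul_of_nonneg_left hd ht.1
        have e2 : S * t * (1 - t) * b ^ 2 ≤ S * t * b ^ 2 := by
          have : 0 ≤ S * t * t * b ^ 2 := by have := ht.1; positivity
          nlinarith
        rw [hst]
        nlinarith
      have c3 : s * (3 / 2 * a) ≤ f ^ 2 - a ^ 2 := by
        refine le_trans (mul_le_mul_of_nonneg_left ?_ hs0.le) c2
        have : S * b ≤ S * (η * a) := mul_le_mul_of_nonneg_left hba.le (by linarith)
        nlinarith
      have hsa : s ≤ a := by nlinarith
      have c4 : a + s / 2 ≤ f := by
        by_contra hc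
        push Not at hc
        nlinarith
      rw [hxy, abs_of_nonpos (by linarith), abs_of_nonpos (by linarith)]
      linarith
    · obtain ⟨m1, m2, m3⟩ := hG.2 j i hj
      have := move_aux hS hC hη hη1 hconc hsemi (p j) γ hγ (by rw [g0]; exact (hG.1 j).1)
        (by rw [g0]; exact (hG.1 j).2.2.2.2)
        (by
          rw [g0, g1, ← hbdef]
          have : 0 < dist (p j) x := (hG.1 j).1
          nlinarith)
        (by rw [g0, g1, ← hbdef, ← hl]; exact m3.le) _ ht
      rw [g0, g1, ← hbdef, div_mul_cancel₀ _ hb0.ne'] at this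
      rw [hxy]; exact this
  · -- move towards `p i`
    obtain ⟨γ, hγ, g0, g1⟩ := hgeo x (p i)
    have hl : dist x (p i) = dist (p i) x := dist_comm _ _
    set a := dist (p i) x with hadef
    set s := min a (a - v i) with hs
    have hs0 : 0 < s := lt_min a0 (by linarith)
    have hsb : s ≤ a := min_le_left _ _
    have hsv : s ≤ a - v i := min_le_right _ _
    have ht : s / a ∈ Icc (0:ℝ) 1 := ⟨by positivity, by rwa [div_le_one a0]⟩
    have hxy : dist x (γ (s / a)) = s := by
      have := hγ 0 ⟨le_rfl, zero_le_one⟩ _ ht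
      rw [g0, g1, zero_sub, abs_neg, abs_of_nonneg ht.1, hl, div_mul_cancel₀ _ a0.ne'] at this
      exact this
    refine ⟨γ (s / a), by rwa [hxy], ?_, fun j hj => ?_⟩
    · have := hγ 1 ⟨zero_le_one, le_rfl⟩ _ ht
      rw [g0, g1, abs_of_nonneg (by linarith [ht.2]), hl, sub_mul, div_mul_cancel₀ _ a0.ne',
        one_mul] at this
      rw [this, hxy, abs_of_nonneg (by linarith), abs_of_nonneg (by linarith)]
      linarith
    · obtain ⟨m1, m2, m3⟩ := hG.2 j i hj
      have := move_aux hS hC hη hη1 hconc hsemi (p j) γ hγ (by rw [g0]; exact (hG.1 j).1)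
        (by rw [g0]; exact (hG.1 j).2.2.2.2)
        (by rw [g0, g1, hl]; exact m1.le)
        (by rw [g0, g1, hl]; exact m2.le) _ ht
      rw [g0, g1, hl, div_mul_cancel₀ _ a0.ne'] at this
      rw [hxy]; exact this

lemma sum_step {k : ℕ} (i : Fin k) (u w : Fin k → ℝ) (s e : ℝ) (hs : 0 ≤ s)
    (he : e ≤ (1 / (4 * k : ℝ)) ^ (k + 1))
    (hi : u i ≤ w i - s / 2) (hlt : ∀ j < i, u j ≤ w j + e * s) (hgt : ∀ j, i < j → u j ≤ w j + s) :
    ∑ j : Fin k, (1 / (4 * k : ℝ)) ^ (j : ℕ) * u j + (1 / (4 * k : ℝ)) ^ k / 4 * s ≤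
      ∑ j : Fin k, (1 / (4 * k : ℝ)) ^ (j : ℕ) * w j := by
  have hk : (1:ℝ) ≤ k := by exact_mod_cast (Nat.one_le_iff_ne_zero.2 (by have := i.2; omega))
  set r : ℝ := 1 / (4 * k : ℝ) with hr
  have hr0 : 0 < r := by positivity
  have hr1 : r ≤ 1 := by rw [hr, div_le_one (by positivity)]; linarith
  have hrk : r * k = 1 / 4 := by rw [hr]; field_simp
  have hmain : ∑ j : Fin k, r ^ (j : ℕ) * (u j - w j) ≤ - (r ^ (i : ℕ) * s / 4) := by
    rw [← Finset.add_sum_erase _ _ (Finset.mem_univ i)]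
    have h1 : r ^ (i : ℕ) * (u i - w i) ≤ - (r ^ (i : ℕ) * s / 2) := by
      have := mul_le_mul_of_nonneg_left (show u i - w i ≤ - (s / 2) by linarith)
        (show 0 ≤ r ^ (i : ℕ) by positivity)
      linarith
    have h2 : ∑ j ∈ Finset.univ.erase i, r ^ (j : ℕ) * (u j - w j) ≤
        (Finset.univ.erase i).card • (r ^ ((i : ℕ) + 1) * s) := by
      apply Finset.sum_le_card_nsmul
      intro j hj
      rcases lt_or_gt_of_ne (Finset.ne_of_mem_erase hj) with h | h
      · calc r ^ (j : ℕ) * (u j - w j) ≤ r ^ (j : ℕ) * (e * s) :=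
              mul_le_mul_of_nonneg_left (by linarith [hlt j h]) (by positivity)
          _ ≤ r ^ (j : ℕ) * (r ^ (k + 1) * s) := by gcongr
          _ ≤ 1 * (r ^ (k + 1) * s) :=
              mul_le_mul_of_nonneg_right (pow_le_one₀ hr0.le hr1) (by positivity)
          _ ≤ r ^ ((i : ℕ) + 1) * s := by
              rw [one_mul]
              exact mul_le_mul_of_nonneg_right
                (pow_le_pow_of_le_one hr0.le hr1 (by have := i.2; omega)) hs
      · calc r ^ (j : ℕ) * (u j - w j) ≤ r ^ (j : ℕ) * s :=
              mul_le_mul_of_nonneg_left (by linarith [hgt j h]) (by positivity)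
          _ ≤ r ^ ((i : ℕ) + 1) * s :=
              mul_le_mul_of_nonneg_right (pow_le_pow_of_le_one hr0.le hr1 h) hs
    have h3 : (Finset.univ.erase i).card • (r ^ ((i : ℕ) + 1) * s) ≤ r ^ (i : ℕ) * s / 4 := by
      rw [nsmul_eq_mul]
      have : ((Finset.univ.erase i).card : ℝ) ≤ k := by
        have := Finset.card_erase_le (s := (Finset.univ : Finset (Fin k))) (a := i)
        rw [Finset.card_univ, Fintype.card_fin] at this
        exact_mod_cast this
      calc _ ≤ (k : ℝ) * (r ^ ((i : ℕ) + 1) * s) :=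
            mul_le_mul_of_nonneg_right this (by positivity)
        _ = (r * k) * (r ^ (i : ℕ) * s) := by ring
        _ = _ := by rw [hrk]; ring
    linarith
  have h4 : r ^ k ≤ r ^ (i : ℕ) := pow_le_pow_of_le_one hr0.le hr1 i.2.le
  have h5 := mul_le_mul_of_nonneg_right h4 hs
  simp only [mul_sub, Finset.sum_sub_distrib] at hmain
  linarith

lemma le_dimH_of_good [CompleteSpace X] {S C D η : ℝ} (hS : 1 ≤ S) (hC : 0 ≤ C) (hη : 0 < η)
    (hη1 : η ≤ 1 / 2) (hη2 : (2 + S) * η ≤ 1 / 2) (hgeo : IsGeodesicSpace X)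
    (hconc : SConcave X S) (hsemi : LocSemiConvex X C D) {k : ℕ} {p q : Fin k → X} {x0 : X}
    (hη3 : η * (3 + S + C) ≤ (1 / (4 * k : ℝ)) ^ (k + 1))
    (hG : Good η D p q x0) : (k : ENNReal) ≤ dimH (univ : Set X) := by
  obtain ⟨r, hr, hball⟩ := Metric.isOpen_iff.1 (isOpen_good η D p q) x0 hG
  rcases Nat.eq_zero_or_pos k with rfl | hk
  · simp
  let F : X → Fin k → ℝ := fun x i => dist (p i) x
  set c : ℝ := (1 / (4 * k : ℝ)) ^ k / 4 with hc
  have hc0 : 0 < c := by positivity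
  let φ : (Fin k → ℝ) → X → ℝ := fun v x =>
    ∑ j : Fin k, (1 / (4 * k : ℝ)) ^ (j : ℕ) * |dist (p j) x - v j|
  have hφ0 : ∀ v x, 0 ≤ φ v x := fun v x => Finset.sum_nonneg fun j _ => by positivity
  have hsolve : ∀ v, φ v x0 < c * r → v ∈ range F := by
    intro v hv
    obtain ⟨x, hx1, hx2⟩ := ekeland_weak (φ v) (by fun_prop) (hφ0 v) c hc0 x0
    have hxr : x ∈ ball x0 r := by
      rw [mem_ball, dist_comm]
      have := hφ0 v x
      by_contra h
      push Not at h
      nlinarith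
    refine ⟨x, ?_⟩
    funext i
    by_contra hi
    obtain ⟨y, y1, y2, y3⟩ := step_aux hS hC hη hη1 hη2 hgeo hconc hsemi (hball hxr) v i hi
    have hlip : ∀ j, |dist (p j) y - dist (p j) x| ≤ dist x y := fun j => by
      rw [dist_comm x y, dist_comm (p j) y, dist_comm (p j) x]
      exact abs_dist_sub_le y x (p j)
    have habs : ∀ j, |dist (p j) y - v j| ≤
        |dist (p j) x - v j| + |dist (p j) y - dist (p j) x| := fun j => by
      have := abs_add_le (dist (p j) x - v j) (dist (p j) y - dist (p j) x)
      rwa [show dist (p j) x - v j + (dist (p j) y - dist (p j) x) = dist (p j) y - v j by ring]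
        at this
    have := sum_step i (fun j => |dist (p j) y - v j|) (fun j => |dist (p j) x - v j|)
      (dist x y) _ y1.le hη3 y2 (fun j hj => (habs j).trans (by linarith [y3 j hj]))
      (fun j _ => (habs j).trans (by linarith [hlip j]))
    have := hx2 y this
    rw [this, dist_self] at y1
    exact lt_irrefl _ y1
  have hnhds : range F ∈ 𝓝 (F x0) := by
    have hcont : Continuous fun v => φ v x0 := by fun_prop
    have h0 : φ (F x0) x0 = 0 := by simp [φ, F]
    have : ∀ᶠ v in 𝓝 (F x0), φ v x0 < c * r :=
      hcont.continuousAt.eventually_lt_const (by change φ (F x0) x0 < c * r; rw [h0]; positivity)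
    filter_upwards [this] with v hv using hsolve v hv
  have hlip : LipschitzWith 1 F := by
    apply LipschitzWith.of_dist_le_mul
    intro x y
    rw [NNReal.coe_one, one_mul, dist_pi_le_iff dist_nonneg]
    intro i
    rw [Real.dist_eq]
    simp only [F]
    rw [dist_comm (p i) x, dist_comm (p i) y]
    exact abs_dist_sub_le x y (p i)
  have h1 := hlip.dimH_range_le
  rw [Real.dimH_of_mem_nhds hnhds] at h1
  simpa using h1

/-- The set of points admitting a `Good` tuple of length `k`. -/
def GoodSet (X : Type*) [MetricSpace X] (η D : ℝ) (k : ℕ) : Set X :=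
  {x : X | ∃ p q : Fin k → X, Good η D p q x}

/-- The distance map of a tuple. -/
def distMap {k : ℕ} (p : Fin k → X) (x : X) : Fin k → ℝ := fun i => dist (p i) x

lemma distMap_lip {k : ℕ} (p : Fin k → X) : LipschitzWith 1 (distMap p) := by
  apply LipschitzWith.of_dist_le_mul
  intro x y
  rw [NNReal.coe_one, one_mul, dist_pi_le_iff dist_nonneg]
  intro i
  rw [Real.dist_eq]
  simp only [distMap]
  rw [dist_comm (p i) x, dist_comm (p i) y]
  exact abs_dist_sub_le x y (p i)

lemma extend_local {S C D η : ℝ} (hS : 1 ≤ S) (hC : 0 ≤ C) (hD : 0 < D) (hη : 0 < η)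
    (hη1 : η ≤ 1 / 2) (hgeo : IsGeodesicSpace X)
    (hconc : SConcave X S) (hsemi : LocSemiConvex X C D) {k : ℕ} {p q : Fin k → X} {x0 : X}
    (hG : Good η D p q x0) :
    ∃ ε > 0, ∀ x ∈ ball x0 ε, ∀ y ∈ ball x0 ε,
      dist (distMap p x) (distMap p y) < ε * dist x y →
      (∃ z, z ≠ x ∧ dist y x + dist x z = dist y z) → x ∈ GoodSet X η D (k + 1) := by
  obtain ⟨ε, hε, -, h⟩ := extend_good hS hC hD hη hη1 hgeo hconc hsemi hG
  refine ⟨ε / 2, by positivity, ?_⟩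
  rintro x hx y hy hF ⟨z, hzx, hz⟩
  have hyx : y ≠ x := by
    rintro rfl
    simp at hF
  have ha : 0 < dist y x := dist_pos.2 hyx
  obtain ⟨γ, hγ, g0, g1⟩ := hgeo x z
  have hl : 0 < dist x z := dist_pos.2 (Ne.symm hzx)
  set t := min 1 (ε * dist y x / dist x z) with ht
  have ht0 : 0 < t := lt_min one_pos (by positivity)
  have ht1 : t ≤ 1 := min_le_left _ _
  have ht2 : t * dist x z ≤ ε * dist y x := by
    rw [← le_div_iff₀ hl]; exact min_le_right _ _
  have d1 : dist x (γ t) = t * dist x z := by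
    have := hγ 0 ⟨le_rfl, zero_le_one⟩ t ⟨ht0.le, ht1⟩
    rwa [g0, g1, zero_sub, abs_neg, abs_of_pos ht0] at this
  have d2 : dist (γ t) z = (1 - t) * dist x z := by
    have := hγ t ⟨ht0.le, ht1⟩ 1 ⟨zero_le_one, le_rfl⟩
    rwa [g0, g1, abs_of_nonpos (by linarith), neg_sub] at this
  refine ⟨_, _, h x (ball_subset_ball (by linarith) hx) y (γ t) hyx ?_ ?_ ?_ ?_ ?_⟩
  · intro e
    rw [e, dist_self] at d1
    have := mul_pos ht0 hl
    linarith
  · apply le_antisymm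
    · have := dist_triangle y (γ t) z
      rw [d2] at this
      rw [d1]
      linarith
    · exact dist_triangle _ _ _
  · rw [d1]; exact ht2
  · rw [mem_ball] at hx hy
    have := dist_triangle_right y x x0
    linarith
  · intro i
    have h1 : dist (distMap p x i) (distMap p y i) ≤ dist (distMap p x) (distMap p y) :=
      dist_le_pi_dist _ _ i
    rw [Real.dist_eq, abs_sub_comm] at h1
    rw [dist_comm x y] at hF
    simp only [distMap] at h1 hF ⊢
    nlinarith

lemma antilip_of_ext {S C D η : ℝ} (hS : 1 ≤ S) (hC : 0 ≤ C) (hD : 0 < D) (hη : 0 < η)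
    (hη1 : η ≤ 1 / 2) (hgeo : IsGeodesicSpace X)
    (hconc : SConcave X S) (hsemi : LocSemiConvex X C D) {k : ℕ} {p q : Fin k → X} {x0 : X}
    (hG : Good η D p q x0) :
    ∃ ε > 0, ∀ x ∈ ball x0 ε, x ∉ GoodSet X η D (k + 1) → ∀ Q : Set X, Dense Q →
      (∀ y ∈ Q, y ≠ x → ∃ z, z ≠ x ∧ dist y x + dist x z = dist y z) → ∀ y ∈ ball x0 ε,
      dist x y ≤ ε⁻¹ * dist (distMap p x) (distMap p y) := by
  obtain ⟨ε, hε, h⟩ := extend_local hS hC hD hη hη1 hgeo hconc hsemi hG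
  refine ⟨ε, hε, fun x hx hxG Q hQ hQx y hy => ?_⟩
  by_contra hc
  push Not at hc
  rw [inv_mul_lt_iff₀ hε] at hc
  have hcont := (distMap_lip p).continuous
  have hopen : IsOpen {y' | y' ∈ ball x0 ε ∧
      dist (distMap p x) (distMap p y') < ε * dist x y'} :=
    isOpen_ball.and (isOpen_lt (by fun_prop) (by fun_prop))
  obtain ⟨y', ⟨h1, h2⟩, h3⟩ := hQ.inter_open_nonempty _ hopen ⟨y, hy, hc⟩
  refine hxG (h x hx y' h1 h2 (hQx y' h3 ?_))
  rintro rfl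
  simp at h2

lemma antilip_of_empty {S C D η : ℝ} (hS : 1 ≤ S) (hC : 0 ≤ C) (hD : 0 < D) (hη : 0 < η)
    (hη1 : η ≤ 1 / 2) (hgeo : IsGeodesicSpace X)
    (hconc : SConcave X S) (hsemi : LocSemiConvex X C D) {k : ℕ} {p q : Fin k → X} {x0 : X}
    (hG : Good η D p q x0) (hemp : GoodSet X η D (k + 1) = ∅) :
    ∃ ε > 0, ∀ x ∈ ball x0 ε, ∀ y ∈ ball x0 ε,
      dist x y ≤ ε⁻¹ * dist (distMap p x) (distMap p y) := by
  obtain ⟨ε, hε, h⟩ := extend_local hS hC hD hη hη1 hgeo hconc hsemi hG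
  refine ⟨ε, hε, fun x hx y hy => ?_⟩
  by_contra hc
  push Not at hc
  rw [inv_mul_lt_iff₀ hε] at hc
  have hcont := (distMap_lip p).continuous
  have hopen : IsOpen {x' | x' ∈ ball x0 ε ∧
      dist (distMap p x') (distMap p y) < ε * dist x' y} :=
    isOpen_ball.and (isOpen_lt (by fun_prop) (by fun_prop))
  obtain ⟨r, hr, hball⟩ := Metric.isOpen_iff.1 hopen x ⟨hx, hc⟩
  obtain ⟨γ, hγ, g0, g1⟩ := hgeo x y
  have hl : 0 < dist x y := by
    have : 0 ≤ dist (distMap p x) (distMap p y) := dist_nonneg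
    by_contra h'
    push Not at h'
    nlinarith
  set t := min (1 / 2) (r / (2 * dist x y)) with ht
  have ht0 : 0 < t := lt_min (by norm_num) (by positivity)
  have ht1 : t ≤ 1 / 2 := min_le_left _ _
  have ht2 : t * (2 * dist x y) ≤ r := by
    rw [← le_div_iff₀ (by positivity)]; exact min_le_right _ _
  have d1 : dist x (γ t) = t * dist x y := by
    have := hγ 0 ⟨le_rfl, zero_le_one⟩ t ⟨ht0.le, by linarith⟩
    rwa [g0, g1, zero_sub, abs_neg, abs_of_pos ht0] at this
  have d2 : dist (γ t) y = (1 - t) * dist x y := by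
    have := hγ t ⟨ht0.le, by linarith⟩ 1 ⟨zero_le_one, le_rfl⟩
    rwa [g0, g1, abs_of_nonpos (by linarith), neg_sub] at this
  have hpos := mul_pos ht0 hl
  obtain ⟨h1, h2⟩ := hball (show γ t ∈ ball x r by rw [mem_ball, dist_comm, d1]; linarith)
  have := h (γ t) h1 y hy h2 ⟨x, ?_, ?_⟩
  · rw [hemp] at this; exact this
  · intro e
    rw [← e, dist_self] at d1
    linarith
  · rw [dist_comm y, dist_comm y, dist_comm _ x, d1, d2]; ring

lemma exists_contract (hgeo : IsGeodesicSpace X) (p : X) {t : ℝ} (ht0 : 0 < t) (ht1 : t < 1) :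
    ∃ Φ : X → X, ∀ z, dist p (Φ z) = t * dist p z ∧ dist (Φ z) z = (1 - t) * dist p z := by
  have : ∀ z, ∃ x, dist p x = t * dist p z ∧ dist x z = (1 - t) * dist p z := by
    intro z
    obtain ⟨γ, hγ, g0, g1⟩ := hgeo p z
    refine ⟨γ t, ?_, ?_⟩
    · have := hγ 0 ⟨le_rfl, zero_le_one⟩ t ⟨ht0.le, ht1.le⟩
      rwa [g0, g1, zero_sub, abs_neg, abs_of_pos ht0] at this
    · have := hγ t ⟨ht0.le, ht1.le⟩ 1 ⟨zero_le_one, le_rfl⟩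
      rwa [g0, g1, abs_of_nonpos (by linarith), neg_sub] at this
  choose Φ hΦ using this
  exact ⟨Φ, hΦ⟩

lemma contract_measure [MeasurableSpace X] [BorelSpace X] (hgeo : IsGeodesicSpace X)
    (hbus : BusemannConcave X) (p : X) {t : ℝ} (ht0 : 0 < t) (ht1 : t < 1) (R : ℝ) (d : ℕ) :
    μH[(d : ℝ)] (ball p R) ≤ ENNReal.ofReal t⁻¹ ^ d * μH[(d : ℝ)] (Wset p t ∩ ball p (t * R)) := by
  obtain ⟨Φ, hΦ⟩ := exists_contract hgeo p ht0 ht1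
  have h1 := antilip_measure Φ t⁻¹ (by positivity) (ball p R) (fun x _ y _ =>
    contract_lip hgeo hbus ht0 ht1 (hΦ x).1 (hΦ x).2 (hΦ y).1 (hΦ y).2) d (Nat.cast_nonneg d)
  rw [ENNReal.rpow_natCast] at h1
  refine h1.trans ?_
  gcongr
  rintro _ ⟨z, hz, rfl⟩
  refine ⟨⟨z, hΦ z⟩, ?_⟩
  rw [mem_ball, dist_comm] at hz ⊢
  rw [(hΦ z).1]
  exact mul_lt_mul_of_pos_left hz ht0

lemma antilip_separable {Y : Type*} [MetricSpace Y] (F : X → Y) (K : ℝ) (hK : 0 ≤ K) (u : Set X)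
    (h : ∀ x ∈ u, ∀ y ∈ u, dist x y ≤ K * dist (F x) (F y))
    (hs : TopologicalSpace.IsSeparable (F '' u)) : TopologicalSpace.IsSeparable u := by
  classical
  rcases u.eq_empty_or_nonempty with rfl | ⟨x0, hx0⟩
  · exact Set.countable_empty.isSeparable
  have : Nonempty X := ⟨x0⟩
  have hinj : Set.InjOn F u := by
    intro x hx y hy hxy
    have := h x hx y hy
    rw [hxy, dist_self, mul_zero] at this
    exact dist_le_zero.1 this
  let g := Function.invFunOn F u
  have hg : ∀ x ∈ u, g (F x) = x := fun x hx => hinj.leftInvOn_invFunOn hx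
  have hl : LipschitzOnWith (Real.toNNReal K) g (F '' u) := by
    apply LipschitzOnWith.of_dist_le_mul
    rintro _ ⟨x, hx, rfl⟩ _ ⟨y, hy, rfl⟩
    rw [hg x hx, hg y hy, Real.coe_toNNReal K hK]
    exact h x hx y hy
  have hc : Continuous ((F '' u).domRestrict g) := hl.continuousOn.domRestrict
  have := hs.separableSpace
  have h2 := TopologicalSpace.isSeparable_range hc
  refine h2.mono ?_
  intro x hx
  exact ⟨⟨F x, x, hx, rfl⟩, hg x hx⟩

lemma cut_null [CompleteSpace X] [MeasurableSpace X] [BorelSpace X] (hgeo : IsGeodesicSpace X)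
    (hbus : BusemannConcave X) (p : X) (d : ℕ) (hfin : ∀ R, μH[(d : ℝ)] (ball p R) ≠ ⊤) :
    μH[(d : ℝ)] {x | ∀ t, 0 < t → t < 1 → x ∉ Wset p t} = 0 := by
  set N := {x | ∀ t, 0 < t → t < 1 → x ∉ Wset p t} with hN
  have hcov : N ⊆ ⋃ m : ℕ, (N ∩ ball p m) := by
    intro x hx
    obtain ⟨m, hm⟩ := exists_nat_gt (dist x p)
    exact mem_iUnion.2 ⟨m, hx, hm⟩
  refine measure_mono_null hcov (measure_iUnion_null fun m => ?_)
  generalize (m : ℝ) = R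
  set μ : Measure X := μH[(d : ℝ)] with hμ
  have hNfin : μ (N ∩ ball p R) ≠ ⊤ := ne_top_of_le_ne_top (hfin R) (measure_mono inter_subset_right)
  have key : ∀ t, 0 < t → t < 1 → (μ (ball p R)).toReal ≤
      t⁻¹ ^ d * ((μ (ball p R)).toReal - (μ (N ∩ ball p R)).toReal) := by
    intro t ht0 ht1
    set V := Wset p t ∩ ball p (t * R) with hV
    have hVm : MeasurableSet V :=
      (isClosed_Wset hgeo hbus p ht0 ht1).measurableSet.inter measurableSet_ball
    have hVR : V ⊆ ball p R := by
      rintro x ⟨-, hx⟩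
      rw [mem_ball] at hx ⊢
      have : 0 ≤ dist x p := dist_nonneg
      nlinarith
    have hVfin : μ V ≠ ⊤ := ne_top_of_le_ne_top (hfin R) (measure_mono hVR)
    have h1 : μ (N ∩ ball p R) + μ V ≤ μ (ball p R) := by
      rw [← measure_union _ hVm]
      · exact measure_mono (union_subset inter_subset_right hVR)
      · rw [Set.disjoint_left]
        rintro x ⟨hx, -⟩ ⟨hx', -⟩
        exact hx t ht0 ht1 hx'
    have h2 := contract_measure hgeo hbus p ht0 ht1 R d
    have h1' := ENNReal.toReal_mono (hfin R) h1
    rw [ENNReal.toReal_add hNfin hVfin] at h1'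
    have h2' := ENNReal.toReal_mono
      (ENNReal.mul_ne_top (ENNReal.pow_ne_top ENNReal.ofReal_ne_top) hVfin) h2
    rw [ENNReal.toReal_mul, ENNReal.toReal_pow, ENNReal.toReal_ofReal (by positivity)] at h2'
    refine h2'.trans (mul_le_mul_of_nonneg_left ?_ (by positivity))
    linarith
  have hlim : Tendsto (fun t : ℝ => t⁻¹ ^ d * ((μ (ball p R)).toReal - (μ (N ∩ ball p R)).toReal))
      (𝓝[<] 1) (𝓝 ((1:ℝ)⁻¹ ^ d * ((μ (ball p R)).toReal - (μ (N ∩ ball p R)).toReal))) := by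
    apply Tendsto.mono_left _ nhdsWithin_le_nhds
    exact (((tendsto_inv₀ one_ne_zero).pow d).mul_const _)
  have hle : (μ (ball p R)).toReal ≤
      (1:ℝ)⁻¹ ^ d * ((μ (ball p R)).toReal - (μ (N ∩ ball p R)).toReal) := by
    refine ge_of_tendsto hlim ?_
    filter_upwards [Ioo_mem_nhdsLT (show (0:ℝ) < 1 by norm_num)] with t ht using key t ht.1 ht.2
  rw [inv_one, one_pow, one_mul] at hle
  have h0 : (μ (N ∩ ball p R)).toReal = 0 :=
    le_antisymm (by linarith) ENNReal.toReal_nonneg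
  rcases (ENNReal.toReal_eq_zero_iff _).1 h0 with h | h
  · exact h
  · exact absurd h hNfin

lemma ext_of_Wset {y x : X} {t : ℝ} (ht1 : t < 1) (hyx : y ≠ x) (h : x ∈ Wset y t) :
    ∃ z, z ≠ x ∧ dist y x + dist x z = dist y z := by
  obtain ⟨z, h1, h2⟩ := h
  refine ⟨z, ?_, by rw [h1, h2]; ring⟩
  rintro rfl
  have : 0 < dist y z := dist_pos.2 hyx
  nlinarith

lemma exists_eta {S C δ : ℝ} (hS : 1 ≤ S) (hC : 0 ≤ C) (hδ0 : 0 < δ) (hδ : δ < 1 / 2) (n : ℕ) :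
    ∃ η > (0:ℝ), η ≤ 1 / 2 ∧ 2 * η < 1 - Real.cos δ ∧ (S + C) * η < 2 * (1 - Real.cos δ) ∧
      2 * η < Real.sin δ ∧ (2 + S) * η ≤ 1 / 2 ∧
      η * (3 + S + C) ≤ (1 / (4 * ((n + 1 : ℕ) : ℝ))) ^ (n + 1 + 1) := by
  have hpi := Real.pi_gt_three
  have hcos : 0 < 1 - Real.cos δ := by
    have := Real.cos_lt_cos_of_nonneg_of_le_pi le_rfl (by linarith) hδ0
    rw [Real.cos_zero] at this
    linarith
  have hsin : 0 < Real.sin δ := Real.sin_pos_of_pos_of_lt_pi hδ0 (by linarith)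
  have hpow : 0 < (1 / (4 * ((n + 1 : ℕ) : ℝ))) ^ (n + 1 + 1) := by positivity
  have g : ∀ a c : ℝ, 0 < a → 0 < c → ∀ᶠ ε in 𝓝[>] (0:ℝ), a * ε < c := fun a c ha hc => by
    filter_upwards [Ioo_mem_nhdsGT (show 0 < c / a by positivity)] with m hm
    have := hm.2
    rw [lt_div_iff₀ ha] at this
    linarith
  obtain ⟨η, ⟨h1, h2, h3, h4, h5, h6⟩, h0⟩ :=
    (((g 1 (1 / 2) one_pos (by norm_num)).and ((g 2 _ two_pos hcos).and
      ((g (S + C) (2 * (1 - Real.cos δ)) (by linarith) (by linarith)).and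
      ((g 2 _ two_pos hsin).and ((g (2 + S) (1 / 2) (by linarith) (by norm_num)).and
      (g (3 + S + C) _ (by linarith) hpow)))))).and self_mem_nhdsWithin).exists
  exact ⟨η, h0, by linarith, h2, h3, h4, h5.le, by linarith⟩

/-- the non-`(n,δ)`-strained points form an `μH[n]`-null set. -/
theorem stmt_0 {X : Type*} [MetricSpace X] [CompleteSpace X]
    [MeasurableSpace X] [BorelSpace X]
    (S C D : ℝ) (hS : 1 ≤ S) (hC : 0 ≤ C) (hD : 0 < D)
    (hgeo : IsGeodesicSpace X) (hconc : SConcave X S)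
    (hsemi : LocSemiConvex X C D) (hbus : BusemannConcave X)
    (n : ℕ) (hdim : dimH (Set.univ : Set X) = n)
    (δ : ℝ) (hδ0 : 0 < δ) (hδ : δ < 1 / 2) :
    μH[(n : ℝ)] (Set.univ \ strainedPoints X S C D δ n) = 0 := by
  rcases Nat.eq_zero_or_pos n with rfl | hn
  · have : strainedPoints X S C D δ 0 = univ := by
      ext x
      simp only [mem_univ, iff_true]
      exact ⟨Fin.elim0, Fin.elim0, fun j => j.elim0, fun j => j.elim0, fun j => j.elim0⟩
    rw [this, Set.sdiff_self]
    exact measure_empty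
  obtain ⟨η, hη, hη1, a1, a2, a3, a4, a5⟩ := exists_eta hS hC hδ0 hδ n
  -- the working strained points are strained
  have hsub : GoodSet X η D n ⊆ strainedPoints X S C D δ n := by
    rintro x ⟨p, q, hG⟩
    exact ⟨p, q, good_isStrainer hS hC hD hδ0 hδ hη hη1 a1 a2 a3 hG⟩
  -- there are no `n + 1` tuples
  have hempty : GoodSet X η D (n + 1) = ∅ := by
    rw [Set.eq_empty_iff_forall_notMem]
    rintro x ⟨p, q, hG⟩
    have := le_dimH_of_good hS hC hη hη1 a4 hgeo hconc hsemi a5 hG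
    rw [hdim] at this
    have h' : n + 1 ≤ n := by exact_mod_cast this
    omega
  have hzero : ∀ x : X, x ∈ GoodSet X η D 0 := fun x =>
    ⟨Fin.elim0, Fin.elim0, fun j => j.elim0, fun j => j.elim0⟩
  have hne : Nonempty X := by
    by_contra h
    rw [not_nonempty_iff] at h
    rw [Set.univ_eq_empty_iff.2 h, dimH_empty] at hdim
    have : n = 0 := by exact_mod_cast hdim.symm
    omega
  -- the maximal length of a tuple
  obtain ⟨k, hkn, ⟨x0, p0, q0, hG0⟩, hk1⟩ : ∃ k ≤ n, (GoodSet X η D k).Nonempty ∧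
      GoodSet X η D (k + 1) = ∅ := by
    by_contra hcon
    push Not at hcon
    have : ∀ k ≤ n + 1, (GoodSet X η D k).Nonempty := by
      intro k
      induction k with
      | zero => exact fun _ => ⟨hne.some, hzero _⟩
      | succ k ih => exact fun h => hcon k (by omega) (ih (by omega))
    have := this (n + 1) le_rfl
    rw [hempty] at this
    exact Set.not_nonempty_empty this
  obtain ⟨ε, hε, hanti⟩ := antilip_of_empty hS hC hD hη hη1 hgeo hconc hsemi hG0 hk1
  have hfin0 : μH[(k : ℝ)] (ball x0 ε) < ⊤ := by
    refine (antilip_measure (distMap p0) ε⁻¹ (by positivity) _ hanti k (Nat.cast_nonneg k)).trans_lt ?_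
    apply ENNReal.mul_lt_top (ENNReal.rpow_lt_top_of_nonneg (Nat.cast_nonneg k)
      ENNReal.ofReal_ne_top)
    have hvol : (μH[(k : ℝ)] : Measure (Fin k → ℝ)) = volume := by
      have := hausdorffMeasure_pi_real (ι := Fin k)
      rwa [Fintype.card_fin] at this
    rw [hvol]
    have himg : distMap p0 '' ball x0 ε ⊆ closedBall (distMap p0 x0) ε := by
      rintro _ ⟨x, hx, rfl⟩
      have := (distMap_lip p0).dist_le_mul x x0
      rw [NNReal.coe_one, one_mul] at this
      rw [mem_closedBall]
      rw [mem_ball] at hx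
      linarith
    exact (measure_mono himg).trans_lt measure_closedBall_lt_top
  have hsep0 : TopologicalSpace.IsSeparable (ball x0 ε) :=
    antilip_separable (distMap p0) ε⁻¹ (by positivity) _ hanti
      (TopologicalSpace.IsSeparable.of_separableSpace _)
  -- scale
  have hscale : ∀ R : ℝ, ∃ t : ℝ, 0 < t ∧ t < 1 ∧ t * R ≤ ε := by
    intro R
    refine ⟨min (1 / 2) (ε / (|R| + 1)), lt_min (by norm_num) (by positivity),
      (min_le_left _ _).trans_lt (by norm_num), ?_⟩
    have h1 : min (1 / 2) (ε / (|R| + 1)) * R ≤ min (1 / 2) (ε / (|R| + 1)) * (|R| + 1) :=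
      mul_le_mul_of_nonneg_left (by linarith [le_abs_self R])
        (le_min (by norm_num) (by positivity))
    have h2 : min (1 / 2) (ε / (|R| + 1)) * (|R| + 1) ≤ ε := by
      rw [← le_div_iff₀ (by positivity)]; exact min_le_right _ _
    linarith
  have hfinR : ∀ R : ℝ, μH[(k : ℝ)] (ball x0 R) ≠ ⊤ := by
    intro R
    obtain ⟨t, ht0, ht1, htR⟩ := hscale R
    refine ne_top_of_le_ne_top ?_ (contract_measure hgeo hbus x0 ht0 ht1 R k)
    refine ENNReal.mul_ne_top (ENNReal.pow_ne_top ENNReal.ofReal_ne_top) ?_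
    exact ne_top_of_le_ne_top hfin0.ne
      (measure_mono (inter_subset_right.trans (ball_subset_ball htR)))
  have hcover : (univ : Set X) = ⋃ m : ℕ, ball x0 (m : ℝ) := by
    ext x
    simp only [mem_univ, mem_iUnion, true_iff]
    obtain ⟨m, hm⟩ := exists_nat_gt (dist x x0)
    exact ⟨m, hm⟩
  have hsep : TopologicalSpace.SeparableSpace X := by
    rw [← TopologicalSpace.isSeparable_univ_iff, hcover]
    apply TopologicalSpace.IsSeparable.iUnion
    intro m
    obtain ⟨t, ht0, ht1, htR⟩ := hscale m
    obtain ⟨Φ, hΦ⟩ := exists_contract hgeo x0 ht0 ht1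
    refine antilip_separable Φ t⁻¹ (by positivity) _ (fun x _ y _ =>
      contract_lip hgeo hbus ht0 ht1 (hΦ x).1 (hΦ x).2 (hΦ y).1 (hΦ y).2) (hsep0.mono ?_)
    rintro _ ⟨z, hz, rfl⟩
    rw [mem_ball, dist_comm] at hz ⊢
    rw [(hΦ z).1]
    exact (mul_lt_mul_of_pos_left hz ht0).trans_le htR
  have hsc : SecondCountableTopology X := UniformSpace.secondCountable_of_separable X
  -- `k = n`
  have hkn' : k = n := by
    have h1 : dimH (univ : Set X) ≤ k := by
      rw [hcover, dimH_iUnion]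
      refine iSup_le fun m => ?_
      have := dimH_le_of_hausdorffMeasure_ne_top (d := (k : NNReal)) (s := ball x0 (m : ℝ))
        (by simpa using hfinR m)
      simpa using this
    rw [hdim] at h1
    have : n ≤ k := by exact_mod_cast h1
    omega
  subst hkn'
  have hfinAll : ∀ p R, μH[(k : ℝ)] (ball (p : X) R) ≠ ⊤ := fun p R =>
    ne_top_of_le_ne_top (hfinR (R + dist p x0)) (measure_mono (ball_subset_ball' le_rfl))
  -- generic points
  obtain ⟨Q, hQc, hQd⟩ := TopologicalSpace.exists_countable_dense X
  set N : Set X := ⋃ p ∈ Q, {x | ∀ t, 0 < t → t < 1 → x ∉ Wset p t} with hN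
  have hN0 : μH[(k : ℝ)] N = 0 :=
    (measure_biUnion_null_iff hQc).2 fun p _ => cut_null hgeo hbus p k (hfinAll p)
  have hext : ∀ x ∉ N, ∀ y ∈ Q, y ≠ x → ∃ z, z ≠ x ∧ dist y x + dist x z = dist y z := by
    intro x hx y hy hyx
    simp only [hN, mem_iUnion, not_exists] at hx
    have := hx y hy
    simp only [mem_ofPred_eq, not_forall, not_not] at this
    obtain ⟨t, ht0, ht1, hW⟩ := this
    exact ext_of_Wset ht1 hyx hW
  have hstrat : ∀ j < k, μH[(k : ℝ)] ((GoodSet X η D j \ GoodSet X η D (j + 1)) \ N) = 0 := by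
    intro j hj
    refine measure_null_of_locally_null _ ?_
    rintro x1 ⟨⟨⟨p, q, hG⟩, -⟩, -⟩
    obtain ⟨e, he, hA⟩ := antilip_of_ext hS hC hD hη hη1 hgeo hconc hsemi hG
    refine ⟨_, inter_mem_nhdsWithin _ (ball_mem_nhds x1 he), ?_⟩
    have h1 := antilip_measure (distMap p) e⁻¹ (by positivity)
      ((GoodSet X η D j \ GoodSet X η D (j + 1)) \ N ∩ ball x1 e)
      (fun x hx y hy => hA x hx.2 hx.1.1.2 Q hQd (hext x hx.1.2) y hy.2) k (Nat.cast_nonneg k)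
    have h2 : (μH[(k : ℝ)] : Measure (Fin j → ℝ)) univ = 0 := by
      have := hausdorffMeasure_of_dimH_lt (s := (univ : Set (Fin j → ℝ))) (d := (k : NNReal))
        (by rw [Real.dimH_univ_pi_fin]; exact_mod_cast hj)
      simpa using this
    rw [measure_mono_null (subset_univ _) h2, mul_zero] at h1
    exact le_antisymm h1 zero_le
  have hfinal : univ \ strainedPoints X S C D δ k ⊆
      N ∪ ⋃ j ∈ Iio k, ((GoodSet X η D j \ GoodSet X η D (j + 1)) \ N) := by
    rintro x ⟨-, hx⟩
    by_cases hxN : x ∈ N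
    · exact Or.inl hxN
    right
    by_contra hcon
    simp only [mem_iUnion, mem_Iio, not_exists] at hcon
    apply hx
    apply hsub
    have : ∀ j ≤ k, x ∈ GoodSet X η D j := by
      intro j
      induction j with
      | zero => exact fun _ => hzero x
      | succ j ih =>
        intro h
        by_contra h'
        exact hcon j (by omega) ⟨⟨ih (by omega), h'⟩, hxN⟩
    exact this k le_rfl
  refine measure_mono_null hfinal (measure_union_null hN0 ?_)
  exact (measure_biUnion_null_iff (Set.to_countable _)).2 fun j hj => hstrat j hj
end
end

section
/- Let X be an S-concave (S ≥ 1), (C,D)-locally semi-convex, Busemann concave complete geodesic space whose Hausdorff dimension equals n ∈ ℕ. Let 1 ≤ k ≤ n − 1, let U ⊆ X be open, and let (p₁, …, p_k) be a (k,δ)-strainer at every point of U, where 0 < δ < δ_k (δ_k := k⁻¹·2^{−2k−1}) and 4δ < 1/2. Let E ⊆ U be the set of points of U that admit no (k+1, 4δ)-strainer. Then μH[n](E) = 0. -/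
open Set Metric MeasureTheory Filter Topology

noncomputable section

variable {X : Type*} [MetricSpace X]

/-- Contraction towards a point. -/
lemma exists_contraction (hgeo : IsGeodesicSpace X) (hbus : BusemannConcave X) (x : X) (t : ℝ)
    (ht0 : 0 < t) (ht1 : t ≤ 1) :
    ∃ h : X → X, (∀ u, dist x (h u) = t * dist x u) ∧
      ∀ u v, t * dist u v ≤ dist (h u) (h v) := by
  choose g hg hg0 hg1 using fun u => hgeo x u
  refine ⟨fun u => g u t, fun u => ?_, fun u v => ?_⟩
  · have := hg u 0 (by simp) t ⟨ht0.le, ht1⟩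
    rw [hg0, hg1] at this
    rw [this, zero_sub, abs_neg, abs_of_pos ht0]
  · have := hbus (g u) (g v) (hg u) (hg v) (by rw [hg0, hg0]) t 1 ht0 ht1 le_rfl
    rw [hg1, hg1, div_one, le_div_iff₀ ht0] at this
    linarith

/-- Cantor set construction. -/
lemma exists_cantor [CompleteSpace X] (hgeo : IsGeodesicSpace X) (hbus : BusemannConcave X)
    (y : X) (R ε : ℝ) (hε : 0 < ε) (hεR : ε ≤ 2 * R) (N : ℕ) (u : Fin N → X)
    (hu : ∀ i, dist y (u i) ≤ R) (hsep : ∀ i j, i ≠ j → ε ≤ dist (u i) (u j)) :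
    ∃ P : (ℕ → Fin N) → X, ∀ a b : ℕ → Fin N, ∀ m, (∀ i < m, a i = b i) → a m ≠ b m →
      (ε / (16 * R)) ^ (m + 1) * (ε / 2) ≤ dist (P a) (P b) := by
  have hR : 0 < R := by linarith
  set τ := ε / (16 * R) with hτ
  have hτ0 : 0 < τ := by positivity
  have hτ1 : τ ≤ 1 / 8 := by
    rw [hτ, div_le_iff₀ (by positivity)]; linarith
  have hτε : ε = 16 * R * τ := by rw [hτ]; field_simp
  have hpow : ∀ m : ℕ, τ ^ (m + 1) ≤ 1 := fun m => pow_le_one₀ hτ0.le (by linarith)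
  choose h hh1 hh2 using fun (x : X) (m : ℕ) =>
    exists_contraction hgeo hbus x (τ ^ (m + 1)) (by positivity) (hpow m)
  let xs : (ℕ → Fin N) → ℕ → X := fun a m => Nat.rec y (fun m z => h z m (u (a m))) m
  have xs0 : ∀ a, xs a 0 = y := fun a => rfl
  have xsS : ∀ a m, xs a (m + 1) = h (xs a m) m (u (a m)) := fun a m => rfl
  have hstep : ∀ a m, dist (xs a m) (xs a (m + 1)) = τ ^ (m + 1) * dist (xs a m) (u (a m)) := by
    intro a m; rw [xsS, hh1]
  have hp2 : ∀ m : ℕ, τ ^ (m + 1) ≤ (1 / 2) ^ m / 8 := by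
    intro m
    have h1 : τ ^ m ≤ (1 / 2) ^ m := by gcongr; linarith
    have h2 : (0:ℝ) < τ ^ m := by positivity
    rw [pow_succ]; nlinarith
  have hbd : ∀ a m, dist y (xs a m) ≤ 2 * R - 2 * R * (1 / 2) ^ m := by
    intro a m
    induction m with
    | zero => simp [xs0]
    | succ m ih =>
      have h1 := dist_triangle y (xs a m) (xs a (m + 1))
      rw [hstep] at h1
      have h2 : dist (xs a m) (u (a m)) ≤ 3 * R := by
        have := dist_triangle_left (xs a m) (u (a m)) y
        have h3 : (0:ℝ) < (1 / 2) ^ m := by positivity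
        nlinarith [hu (a m)]
      have h4 : τ ^ (m + 1) * dist (xs a m) (u (a m)) ≤ ((1 / 2) ^ m / 8) * (3 * R) :=
        mul_le_mul (hp2 m) h2 dist_nonneg (by positivity)
      have h5 : (0:ℝ) < R * (1 / 2) ^ m := by positivity
      have h6 : (1 / 2 : ℝ) ^ (m + 1) = (1 / 2) ^ m * (1 / 2) := pow_succ _ _
      rw [h6]
      nlinarith
  have hst3 : ∀ a m, dist (xs a m) (xs a (m + 1)) ≤ (3 * R * τ) * τ ^ m := by
    intro a m
    rw [hstep]
    have h2 : dist (xs a m) (u (a m)) ≤ 3 * R := by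
      have := dist_triangle_left (xs a m) (u (a m)) y
      have h3 : (0:ℝ) < (1 / 2) ^ m := by positivity
      nlinarith [hu (a m), hbd a m]
    rw [pow_succ]
    have : 0 < τ ^ m * τ := by positivity
    nlinarith
  have hτlt : τ < 1 := by linarith
  have hc : ∀ a, ∃ z, Tendsto (xs a) atTop (𝓝 z) := fun a =>
    cauchySeq_tendsto_of_complete (cauchySeq_of_le_geometric _ _ hτlt (hst3 a))
  choose P hP using hc
  refine ⟨P, fun a b m hab hne => ?_⟩
  have hlim : ∀ a m, dist (xs a (m + 1)) (P a) ≤ 4 * R * τ * τ ^ (m + 1) := by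
    intro a m
    have := dist_le_of_le_geometric_of_tendsto _ _ hτlt (hst3 a) (hP a) (m + 1)
    refine this.trans ?_
    rw [div_le_iff₀ (by linarith)]
    have : 0 < R * τ * τ ^ (m + 1) := by positivity
    nlinarith
  have heq : ∀ i ≤ m, xs a i = xs b i := by
    intro i
    induction i with
    | zero => intro _; rw [xs0, xs0]
    | succ i ih => intro hi; rw [xsS, xsS, ih (by omega), hab i (by omega)]
  have h1 : τ ^ (m + 1) * ε ≤ dist (xs a (m + 1)) (xs b (m + 1)) := by
    rw [xsS, xsS, heq m le_rfl]
    refine le_trans ?_ (hh2 _ _ _ _)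
    have := hsep _ _ hne
    gcongr
  have h2 := hlim a m
  have h3 := hlim b m
  have h4 := dist_triangle4 (xs a (m + 1)) (P a) (P b) (xs b (m + 1))
  rw [dist_comm (P b)] at h4
  have h5 : 4 * R * τ = ε / 4 := by rw [hτε]; ring
  rw [h5] at h2 h3
  linarith

lemma sep_card [CompleteSpace X] (hgeo : IsGeodesicSpace X) (hbus : BusemannConcave X)
    (n : ℕ) (hdim : dimH (Set.univ : Set X) = n)
    (y : X) (R ε : ℝ) (hε : 0 < ε) (N : ℕ) (hN : 2 ≤ N) (u : Fin N → X)
    (hu : ∀ i, dist y (u i) ≤ R) (hsep : ∀ i j, i ≠ j → ε ≤ dist (u i) (u j)) :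
    (N : ℝ) ≤ (16 * R / ε) ^ n := by
  have hεR : ε ≤ 2 * R := by
    have h1 := hsep ⟨0, by omega⟩ ⟨1, by omega⟩ (by simp)
    have h2 := dist_triangle_left (u ⟨0, by omega⟩) (u ⟨1, by omega⟩) y
    linarith [hu ⟨0, by omega⟩, hu ⟨1, by omega⟩]
  have hR : 0 < R := by linarith
  obtain ⟨P, hP⟩ := exists_cantor hgeo hbus y R ε hε hεR N u hu hsep
  set τ := ε / (16 * R) with hτ
  have hτ0 : 0 < τ := by positivity
  have hτ1 : τ ≤ 1 / 8 := by
    rw [hτ, div_le_iff₀ (by positivity)]; linarith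
  have hfirst : ∀ a b : ℕ → Fin N, a ≠ b → ∃ m, (∀ i < m, a i = b i) ∧ a m ≠ b m := by
    classical
    intro a b hab
    have hex : ∃ m, a m ≠ b m := Function.ne_iff.1 hab
    exact ⟨Nat.find hex, fun i hi => not_not.1 (Nat.find_min hex hi), Nat.find_spec hex⟩
  have hinj : Function.Injective P := by
    intro a b hab
    by_contra hne
    obtain ⟨m, hm, hm'⟩ := hfirst a b hne
    have := hP a b m hm hm'
    rw [hab, dist_self] at this
    have : 0 < τ ^ (m + 1) * (ε / 2) := by positivity
    linarith
  have hNR : (1:ℝ) < N := by exact_mod_cast hN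
  have hlogN : 0 < Real.log N := Real.log_pos hNR
  have hlogτ : 0 < - Real.log τ := by
    have := Real.log_neg hτ0 (by linarith)
    linarith
  set α : ℝ := Real.log N / (- Real.log τ) with hα
  have hα0 : 0 < α := by positivity
  have hτα : τ ^ α = (N:ℝ)⁻¹ := by
    rw [Real.rpow_def_of_pos hτ0, hα]
    have : Real.log τ * (Real.log N / -Real.log τ) = - Real.log N := by
      have hne : Real.log τ ≠ 0 := by intro h0; rw [h0] at hlogτ; simp at hlogτ
      field_simp
    rw [this, Real.exp_neg, Real.exp_log (by linarith)]
  have : Nonempty (Fin N) := ⟨⟨0, by omega⟩⟩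
  let f : X → ℝ := fun x => Real.ofDigits (Function.invFun P x)
  have hf : ∀ a, f (P a) = Real.ofDigits a := fun a => by
    simp only [f]; rw [Function.leftInverse_invFun hinj]
  let K0 : ℝ := (2 / (τ * ε)) ^ α
  have hK0 : 0 ≤ K0 := by positivity
  have hhol : HolderOnWith K0.toNNReal α.toNNReal f (Set.range P) := by
    rintro _ ⟨a, rfl⟩ _ ⟨b, rfl⟩
    rw [hf, hf]
    by_cases hab : a = b
    · simp [hab]
    obtain ⟨m, hm, hm'⟩ := hfirst a b hab
    have h1 := hP a b m hm hm'
    have h2 := Real.abs_ofDigits_sub_ofDigits_le hm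
    rw [edist_dist, edist_dist, Real.coe_toNNReal _ hα0.le, ENNReal.ofReal_rpow_of_nonneg dist_nonneg hα0.le,
      ← ENNReal.ofReal, ← ENNReal.ofReal_mul hK0]
    apply ENNReal.ofReal_le_ofReal
    rw [Real.dist_eq]
    refine h2.trans ?_
    have h3 : (τ ^ (m + 1) * (ε / 2)) ^ α ≤ dist (P a) (P b) ^ α :=
      Real.rpow_le_rpow (by positivity) h1 hα0.le
    have h4 : ((N:ℝ) ^ m)⁻¹ = K0 * (τ ^ (m + 1) * (ε / 2)) ^ α := by
      simp only [K0]
      rw [← Real.mul_rpow (by positivity) (by positivity)]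
      have : 2 / (τ * ε) * (τ ^ (m + 1) * (ε / 2)) = τ ^ m := by
        rw [pow_succ]; field_simp
      rw [this, ← Real.rpow_natCast τ m, ← Real.rpow_mul hτ0.le, mul_comm, Real.rpow_mul hτ0.le, hτα,
        Real.rpow_natCast, inv_pow]
    rw [h4]
    gcongr
  have himg : f '' (Set.range P) = Set.Icc 0 1 := by
    apply Set.Subset.antisymm
    · rintro _ ⟨_, ⟨a, rfl⟩, rfl⟩
      rw [hf]
      exact ⟨Real.ofDigits_nonneg a, Real.ofDigits_le_one a⟩
    · intro z hz
      obtain ⟨a, -, ha⟩ := Real.ofDigits_SurjOn (b := N) (by omega) hz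
      exact ⟨P a, ⟨a, rfl⟩, by rw [hf, ha]⟩
  have hd := hhol.dimH_image_le (by simpa using hα0)
  rw [himg, Real.dimH_of_nonempty_interior (by simp)] at hd
  have hd2 : dimH (Set.range P) ≤ n := hdim ▸ dimH_mono (Set.subset_univ _)
  have hd3 : (1 : ENNReal) ≤ n / (α.toNNReal : ENNReal) := by
    refine le_trans ?_ (ENNReal.div_le_div_right hd2 _)
    simpa using hd
  have hα' : (α.toNNReal : ENNReal) ≠ 0 := by simpa using hα0
  rw [ENNReal.le_div_iff_mul_le (Or.inl hα') (Or.inl ENNReal.coe_ne_top), one_mul] at hd3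
  have hαn : α ≤ n := by
    have : α.toNNReal ≤ (n : NNReal) := by exact_mod_cast hd3
    rw [Real.toNNReal_le_iff_le_coe] at this
    simpa using this
  rw [hα, div_le_iff₀ hlogτ] at hαn
  have : 16 * R / ε = τ⁻¹ := by rw [hτ, inv_div]
  rw [this, ← Real.log_le_log_iff (by linarith) (by positivity), Real.log_pow, Real.log_inv]
  exact hαn

/-- Finite nets with a cardinality bound. -/
lemma exists_net [CompleteSpace X] (hgeo : IsGeodesicSpace X) (hbus : BusemannConcave X)
    (n : ℕ) (hdim : dimH (Set.univ : Set X) = n)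
    (y : X) (R ε : ℝ) (hR : 0 < R) (hε : 0 < ε) :
    ∃ A : Finset X, (A.card : ℝ) ≤ 1 + (16 * R / ε) ^ n ∧
      closedBall y R ⊆ ⋃ a ∈ A, closedBall a ε := by
  classical
  let Q : ℕ → Prop := fun m => ∃ A : Finset X, A.card = m ∧ (∀ a ∈ A, dist y a ≤ R) ∧
    ∀ a ∈ A, ∀ b ∈ A, a ≠ b → ε ≤ dist a b
  have hpos : 0 ≤ (16 * R / ε) ^ n := by positivity
  have hQ : ∀ m, Q m → (m : ℝ) ≤ 1 + (16 * R / ε) ^ n := by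
    rintro m ⟨A, hA, h1, h2⟩
    by_cases hm : 2 ≤ m
    · have e : Fin m ≃ A := (Fintype.equivFinOfCardEq (by simpa using hA)).symm
      have := sep_card hgeo hbus n hdim y R ε hε m hm (fun i => (e i : X))
        (fun i => h1 _ (e i).2) (fun i j hij => h2 _ (e i).2 _ (e j).2
          (fun h => hij (e.injective (Subtype.ext h))))
      linarith
    · have : (m : ℝ) ≤ 1 := by exact_mod_cast (by omega : m ≤ 1)
      linarith
  have hQ' : ∀ m, Q m → m ≤ ⌈1 + (16 * R / ε) ^ n⌉₊ := fun m hm => by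
    exact_mod_cast (hQ m hm).trans (Nat.le_ceil _)
  have hQ0 : Q 0 := ⟨∅, rfl, by simp, by simp⟩
  have hmax := Nat.findGreatest_spec (P := Q) (Nat.zero_le ⌈1 + (16 * R / ε) ^ n⌉₊) hQ0
  set M := Nat.findGreatest Q ⌈1 + (16 * R / ε) ^ n⌉₊ with hM
  obtain ⟨A, hA, h1, h2⟩ := id hmax
  refine ⟨A, by rw [hA]; exact hQ M hmax, fun z hz => ?_⟩
  by_contra hcon
  simp only [mem_iUnion, mem_closedBall, not_exists, not_le] at hcon
  have hzA : z ∉ A := fun h => by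
    have := hcon z h; rw [dist_self] at this; linarith
  have hQM : Q (M + 1) := by
    refine ⟨insert z A, by rw [Finset.card_insert_of_notMem hzA, hA], ?_, ?_⟩
    · intro a ha
      rcases Finset.mem_insert.1 ha with rfl | ha
      · rw [dist_comm]; exact hz
      · exact h1 a ha
    · intro a ha b hb hab
      rcases Finset.mem_insert.1 ha with rfl | ha' <;> rcases Finset.mem_insert.1 hb with rfl | hb'
      · exact absurd rfl hab
      · exact (hcon b hb').le
      · rw [dist_comm]; exact (hcon a ha').le
      · exact h2 a ha' b hb' hab
  have := Nat.le_findGreatest (hQ' _ hQM) hQM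
  omega

lemma hausdorff_closedBall_lt_top [CompleteSpace X] [MeasurableSpace X] [BorelSpace X]
    (hgeo : IsGeodesicSpace X) (hbus : BusemannConcave X)
    (n : ℕ) (hdim : dimH (Set.univ : Set X) = n) (y : X) (R : ℝ) (hR : 0 < R) :
    μH[(n : ℝ)] (closedBall y R) < ⊤ := by
  let e : ℕ → ℝ := fun j => (1 / 2) ^ (j + 1)
  have he : ∀ j, 0 < e j := fun j => by positivity
  have he1 : ∀ j, e j ≤ 1 / 2 := fun j => by
    simp only [e, pow_succ]
    have : (1 / 2 : ℝ) ^ j ≤ 1 := pow_le_one₀ (by norm_num) (by norm_num)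
    linarith
  choose A hA1 hA2 using fun j => exists_net hgeo hbus n hdim y R (e j) hR (he j)
  have hlim : Tendsto (fun j => ENNReal.ofReal (2 * e j)) atTop (𝓝 0) := by
    rw [← ENNReal.ofReal_zero]
    apply ENNReal.tendsto_ofReal
    have : Tendsto e atTop (𝓝 0) :=
      (tendsto_pow_atTop_nhds_zero_of_lt_one (by norm_num) (by norm_num)).comp
        (tendsto_add_atTop_nat 1)
    simpa using this.const_mul 2
  have hdiam : ∀ j (a : X), ediam (closedBall a (e j)) ≤ ENNReal.ofReal (2 * e j) := by
    intro j a
    refine Metric.ediam_le_of_forall_dist_le fun x hx z hz => ?_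
    have := dist_triangle_right x z a
    rw [mem_closedBall] at hx hz
    linarith
  have key := MeasureTheory.Measure.hausdorffMeasure_le_liminf_sum (ι := fun j => A j) (n : ℝ) (closedBall y R)
    (l := atTop) _ hlim
    (fun j a => closedBall (a : X) (e j)) (Eventually.of_forall fun j a => hdiam j a)
    (Eventually.of_forall fun j z hz => by
      obtain ⟨a, ha, hz⟩ := mem_iUnion₂.1 (hA2 j hz)
      exact mem_iUnion.2 ⟨⟨a, ha⟩, hz⟩)
  refine key.trans_lt (lt_of_le_of_lt (b := ENNReal.ofReal (1 + (32 * R) ^ n)) ?_ ENNReal.ofReal_lt_top)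
  refine liminf_le_of_le (by isBoundedDefault) fun b hb => ?_
  obtain ⟨j, hj⟩ := hb.exists
  refine hj.trans ?_
  calc ∑ a : A j, ediam (closedBall (a : X) (e j)) ^ (n : ℝ)
      ≤ ∑ a : A j, ENNReal.ofReal ((2 * e j) ^ n) := by
        refine Finset.sum_le_sum fun a _ => ?_
        rw [ENNReal.rpow_natCast, ENNReal.ofReal_pow (by have := he j; positivity)]
        exact pow_le_pow_left₀ (by simp) (hdiam j a) n
    _ = ENNReal.ofReal ((A j).card * (2 * e j) ^ n) := by
        rw [ENNReal.ofReal_mul (by positivity)]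
        simp
    _ ≤ _ := by
        apply ENNReal.ofReal_le_ofReal
        have h1 := hA1 j
        have h2 : 0 ≤ (2 * e j) ^ n := by have := he j; positivity
        have h3 : (2 * e j) ^ n ≤ 1 := pow_le_one₀ (by have := he j; positivity) (by linarith [he1 j])
        have h4 : (16 * R / e j) ^ n * (2 * e j) ^ n = (32 * R) ^ n := by
          rw [← mul_pow]; congr 1
          have := (he j).ne'
          field_simp; norm_num
        nlinarith [mul_le_mul_of_nonneg_right h1 h2]

lemma secondCountable_of_net [CompleteSpace X] (hgeo : IsGeodesicSpace X)
    (hbus : BusemannConcave X) (n : ℕ) (hdim : dimH (Set.univ : Set X) = n) :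
    SecondCountableTopology X := by
  rcases isEmpty_or_nonempty X with hX | ⟨⟨y⟩⟩
  · infer_instance
  refine Metric.secondCountable_of_almost_dense_set fun ε hε => ?_
  choose A hA1 hA2 using fun j : ℕ => exists_net hgeo hbus n hdim y (j + 1) ε (by positivity) hε
  refine ⟨⋃ j, (A j : Set X), countable_iUnion fun j => (A j).countable_toSet, fun z => ?_⟩
  obtain ⟨j, hj⟩ := exists_nat_ge (dist z y)
  obtain ⟨a, ha, hz⟩ := mem_iUnion₂.1 (hA2 j (show z ∈ closedBall y (j + 1) by
    rw [mem_closedBall]; linarith))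
  exact ⟨a, mem_iUnion.2 ⟨j, ha⟩, hz⟩

lemma doubling_hausdorff [MeasurableSpace X] [BorelSpace X]
    (hgeo : IsGeodesicSpace X) (hbus : BusemannConcave X) (n : ℕ) :
    IsUnifLocDoublingMeasure (μH[(n : ℝ)] : Measure X) := by
  refine ⟨⟨2 ^ n, Eventually.of_forall fun ε x => ?_⟩⟩
  obtain ⟨h, h1, h2⟩ := exists_contraction hgeo hbus x (1 / 2) (by norm_num) (by norm_num)
  have hanti : AntilipschitzWith 2 h := AntilipschitzWith.of_le_mul_dist fun u v => by
    have := h2 u v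
    push_cast
    linarith
  refine (hanti.le_hausdorffMeasure_image (Nat.cast_nonneg n) _).trans ?_
  rw [ENNReal.rpow_natCast]
  push_cast
  gcongr
  rintro _ ⟨u, hu, rfl⟩
  rw [mem_closedBall, dist_comm] at hu ⊢
  rw [h1]
  linarith

/-- Points near which `F` is uniformly expanding form a null set. -/
lemma bad_null [SecondCountableTopology X] [MeasurableSpace X] [BorelSpace X]
    (k n : ℕ) (hkn : k + 1 ≤ n) (F : X → Fin k → ℝ) (η : ℝ) (hη : 0 < η) :
    μH[(n : ℝ)] {x : X | ∃ m : ℕ, ∀ y, dist x y < 1 / (m + 1) → η * dist x y ≤ dist (F x) (F y)}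
      = 0 := by
  rcases isEmpty_or_nonempty X with hX | hX
  · rw [Set.eq_empty_of_isEmpty {x : X | _}, measure_empty]
  have hsub : {x : X | ∃ m : ℕ, ∀ y, dist x y < 1 / (m + 1) → η * dist x y ≤ dist (F x) (F y)} ⊆
      ⋃ m : ℕ, ⋃ j : ℕ, {x : X | (∀ y, dist x y < 1 / ((m : ℝ) + 1) →
        η * dist x y ≤ dist (F x) (F y)) ∧ dist x (TopologicalSpace.denseSeq X j) < 1 / (2 * ((m : ℝ) + 1))} := by
    rintro x ⟨m, hm⟩
    obtain ⟨j, hj⟩ := (TopologicalSpace.denseRange_denseSeq X).exists_dist_lt x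
      (show (0:ℝ) < 1 / (2 * ((m : ℝ) + 1)) by positivity)
    exact mem_iUnion₂.2 ⟨m, j, hm, hj⟩
  refine measure_mono_null hsub ?_
  refine measure_iUnion_null fun m => measure_iUnion_null fun j => ?_
  set B := {x : X | (∀ y, dist x y < 1 / ((m : ℝ) + 1) →
        η * dist x y ≤ dist (F x) (F y)) ∧ dist x (TopologicalSpace.denseSeq X j) < 1 / (2 * ((m : ℝ) + 1))}
  have hanti : AntilipschitzWith (η⁻¹).toNNReal (fun x : B => F x) := by
    refine AntilipschitzWith.of_le_mul_dist fun x y => ?_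
    rw [Real.coe_toNNReal _ (by positivity), Subtype.dist_eq, inv_mul_eq_div, le_div_iff₀ hη, mul_comm]
    apply x.2.1
    have h1 := dist_triangle_right (x : X) y (TopologicalSpace.denseSeq X j)
    have h2 := x.2.2
    have h3 := y.2.2
    have h4 : 1 / (2 * ((m : ℝ) + 1)) + 1 / (2 * ((m : ℝ) + 1)) = 1 / ((m : ℝ) + 1) := by
      field_simp; norm_num
    linarith
  have h1 : dimH B ≤ k := by
    calc dimH B = dimH (Subtype.val '' (univ : Set B)) := by simp
      _ = dimH (univ : Set B) := isometry_subtype_coe.dimH_image _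
      _ ≤ dimH ((fun x : B => F x) '' univ) := hanti.le_dimH_image _
      _ ≤ dimH (univ : Set (Fin k → ℝ)) := dimH_mono (subset_univ _)
      _ = k := Real.dimH_univ_pi_fin k
  have h2 := hausdorffMeasure_of_dimH_lt (s := B) (d := (n : NNReal)) (h1.trans_lt (by exact_mod_cast hkn))
  simpa using h2

lemma porous_null [MeasurableSpace X] [BorelSpace X] [SecondCountableTopology X]
    (μ : Measure X) [IsUnifLocDoublingMeasure μ] [IsLocallyFiniteMeasure μ]
    (E G : Set X) (hGE : G ⊆ E) (c : ℝ) (hc : 0 < c)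
    (hpor : ∀ x ∈ G, ∀ e > 0, ∃ s z, 0 < s ∧ s < e ∧ dist x z ≤ s ∧
      Disjoint E (closedBall z (c * s))) : μ G = 0 := by
  have hae := IsUnifLocDoublingMeasure.ae_tendsto_measure_inter_div μ E c⁻¹
  have h2 : ∀ᵐ x ∂μ.restrict E, x ∉ G := by
    filter_upwards [hae] with x hx hxG
    choose s z hs0 hs1 hsz hdis using fun j : ℕ => hpor x hxG (1 / ((j : ℝ) + 1)) (by positivity)
    have hs : Tendsto s atTop (𝓝 0) :=
      squeeze_zero (fun j => (hs0 j).le) (fun j => (hs1 j).le) tendsto_one_div_add_atTop_nhds_zero_nat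
    have hlim : Tendsto (fun j => c * s j) atTop (𝓝[>] 0) := by
      refine tendsto_nhdsWithin_iff.2 ⟨by simpa using hs.const_mul c, Eventually.of_forall fun j => ?_⟩
      exact mul_pos hc (hs0 j)
    have := hx z (fun j => c * s j) hlim (Eventually.of_forall fun j => by
      rw [mem_closedBall, inv_mul_cancel_left₀ hc.ne']; exact hsz j)
    simp only [(hdis _).inter_eq, measure_empty, ENNReal.zero_div] at this
    exact zero_ne_one (tendsto_nhds_unique tendsto_const_nhds this)
  have h3 : μ.restrict E G = 0 := by
    rw [ae_iff] at h2
    simpa using h2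
  have := Measure.restrict_eq_self μ hGE
  rwa [this] at h3

lemma abs_arccos_sub_lt {c θ : ℝ} (hθ0 : 0 < θ) (hθ : θ < 1 / 2) (h : |c| < 1 - Real.cos θ) :
    |Real.arccos c - Real.pi / 2| < θ := by
  have hpi := Real.pi_gt_three
  have hsin : 0 < Real.sin θ := Real.sin_pos_of_pos_of_lt_pi hθ0 (by linarith)
  have hcos : 0 < Real.cos θ := Real.cos_pos_of_mem_Ioo ⟨by linarith, by linarith⟩
  have h1 : 1 - Real.cos θ ≤ Real.sin θ := by
    nlinarith [Real.sin_sq_add_cos_sq θ]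
  rw [abs_lt] at h
  rw [Real.arccos, abs_lt]
  constructor
  · have : Real.arcsin c < θ :=
      (Real.arcsin_lt_iff_lt_sin' ⟨by linarith, by linarith⟩).2 (by linarith)
    linarith
  · have : -θ < Real.arcsin c :=
      (Real.lt_arcsin_iff_sin_lt' ⟨by linarith, by linarith⟩).2 (by rw [Real.sin_neg]; linarith)
    linarith

lemma arccos_one_sub_lt {a θ : ℝ} (hθ0 : 0 < θ) (hθ : θ < 1 / 2) (h : a < 1 - Real.cos θ) :
    Real.arccos (1 - a) < θ := by
  have hpi := Real.pi_gt_three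
  have hcos : 0 < Real.cos θ := Real.cos_pos_of_mem_Ioo ⟨by linarith, by linarith⟩
  by_cases h1 : 1 - a ≤ 1
  · rw [← Real.arccos_cos (x := θ) hθ0.le (by linarith)]
    exact Real.arccos_lt_arccos (by linarith) (by linarith) h1
  · rw [Real.arccos_eq_zero.2 (by linarith)]; exact hθ0

lemma lt_arccos_of_lt {c θ : ℝ} (hθ0 : 0 < θ) (hθ : θ < 1 / 2) (h : c < -1 + (1 - Real.cos θ)) :
    Real.pi - θ < Real.arccos c := by
  have hpi := Real.pi_gt_three
  by_cases h1 : -1 ≤ c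
  · rw [← Real.arccos_cos (x := Real.pi - θ) (by linarith) (by linarith), Real.cos_pi_sub]
    exact Real.arccos_lt_arccos h1 (by linarith) (by linarith [Real.neg_one_le_cos θ])
  · rw [Real.arccos_eq_pi.2 (by linarith)]; linarith

/-- Purely numerical part. -/
lemma num_A {σ l c r a b : ℝ} (hσ0 : 0 < σ) (hσ1 : σ < 1) (hl0 : 0 < l) (hl1 : l ≤ 1 / 16)
    (hc : c = σ / 16) (hr : 0 < r)
    (ha1 : (1 - l) * r - c * l * r ≤ a) (ha2 : a ≤ (1 - l) * r + c * l * r)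
    (hb1 : l * r - c * l * r ≤ b) (hb2 : b ≤ l * r + c * l * r) :
    (a ^ 2 + b ^ 2 - r ^ 2) / (2 * a * b) < -1 + σ := by
  have hlr : 0 < l * r := by positivity
  have hc1 : c ≤ 1 / 16 := by linarith
  have hc0 : 0 < c := by linarith
  have hclr : 0 < c * l * r := by positivity
  have hclr2 : c * l * r ≤ l * r / 16 := by nlinarith
  have hlr2 : l * r ≤ r / 16 := by nlinarith
  have ha : r / 2 ≤ a := by linarith
  have hb : l * r * (3 / 4) ≤ b := by linarith
  have ha0 : 0 < a := by linarith
  have hb0 : 0 < b := by linarith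
  rw [div_lt_iff₀ (by positivity)]
  have hab : a + b ≤ r + 2 * (c * l * r) := by linarith
  have h1 : (a + b) ^ 2 ≤ (r + 2 * (c * l * r)) ^ 2 := by gcongr
  have h2 : (r / 2) * (l * r * (3 / 4)) ≤ a * b := by gcongr
  have h3 : (c * l * r) ^ 2 ≤ (c * l * r) * r := by nlinarith
  have h4 : σ * ((r / 2) * (l * r * (3 / 4))) ≤ σ * (a * b) := by gcongr
  have h5 : c * l * r * r = σ * (l * r * r) / 16 := by rw [hc]; ring
  have h6 : 0 < σ * (l * r * r) := by positivity
  nlinarith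

lemma num_D {σ l η r a P Y : ℝ} (hσ0 : 0 < σ) (hσ1 : σ < 1) (hl0 : 0 < l) (hl1 : l ≤ σ / 16)
    (hη : η = σ / 16) (hr : 0 < r) (hP : r ≤ σ * P / 4) (ha1 : r / 2 ≤ a) (ha2 : a ≤ 2 * r)
    (hP0 : 0 < P) (hY0 : 0 ≤ Y) (hPY : |P - Y| ≤ (2 * l + η) * r) :
    |(P ^ 2 + a ^ 2 - Y ^ 2) / (2 * P * a)| < σ := by
  have ha0 : 0 < a := by linarith
  have hrP : r ≤ P := by nlinarith
  rw [abs_div, abs_of_pos (show 0 < 2 * P * a by positivity), div_lt_iff₀ (by positivity)]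
  have h0 : (2 * l + η) * r ≤ 3 * σ / 16 * r := by gcongr; linarith
  have h1 : |P ^ 2 - Y ^ 2| ≤ (3 * σ / 16 * r) * (3 * P) := by
    have : P ^ 2 - Y ^ 2 = (P - Y) * (P + Y) := by ring
    rw [this, abs_mul, abs_of_nonneg (show 0 ≤ P + Y by positivity)]
    refine mul_le_mul (hPY.trans h0) ?_ (by positivity) (by positivity)
    have := (abs_le.1 (hPY.trans h0)).1
    nlinarith
  have h2 : |P ^ 2 + a ^ 2 - Y ^ 2| ≤ |P ^ 2 - Y ^ 2| + a ^ 2 := by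
    have : P ^ 2 + a ^ 2 - Y ^ 2 = (P ^ 2 - Y ^ 2) + a ^ 2 := by ring
    rw [this]
    exact (abs_add_le _ _).trans (by rw [abs_of_nonneg (sq_nonneg a)])
  have h3 : a ^ 2 ≤ a * (σ * P / 2) := by
    rw [sq]; gcongr; linarith
  have h4 : σ * P * (r / 2) ≤ σ * P * a := by gcongr
  have h5 : 0 < σ * P * r := by positivity
  nlinarith

set_option maxHeartbeats 1000000 in
lemma num_E {σ l η c M r b P Q Y Z : ℝ} (hσ0 : 0 < σ) (hσ1 : σ < 1) (hl0 : 0 < l)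
    (hl1 : l ≤ σ / 16) (hη : η = σ / 16) (hc : c = σ / 16) (hr : 0 < r) (hM1 : 1 ≤ M)
    (hrQ : 8 * M * r ≤ σ * Q) (hPQ : Q ≤ 2 * P)
    (hb1 : l * r * (3 / 4) ≤ b) (hb2 : b ≤ 2 * (l * r)) (hY0 : 0 ≤ Y) (hZ0 : 0 ≤ Z)
    (hYQ : |Y - Q| ≤ η * r) (hPZ : |P - Z| ≤ c * l * r)
    (hZQ : |Z ^ 2 - ((1 - l) * Q ^ 2 + l * Y ^ 2)| ≤ M * l * (1 - l) * r ^ 2) :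
    |(P ^ 2 + b ^ 2 - Q ^ 2) / (2 * P * b)| < σ := by
  have hMr : r ≤ M * r := by nlinarith
  have hQ0 : 0 < Q := by
    have : 0 < σ * Q := by linarith
    exact pos_of_mul_pos_right this hσ0.le
  have hP0 : 0 < P := by linarith
  have hlr : 0 < l * r := by positivity
  have hb0 : 0 < b := by linarith
  have hrQ' : r ≤ Q := by nlinarith
  have hσQP : σ * Q ≤ σ * (2 * P) := by gcongr
  have hMrP : M * r ≤ σ * P / 4 := by linarith
  have hrP : r ≤ P := by nlinarith
  rw [abs_div, abs_of_pos (show 0 < 2 * P * b by positivity), div_lt_iff₀ (by positivity)]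
  have hY2 : |Y ^ 2 - Q ^ 2| ≤ (η * r) * (3 * Q) := by
    have : Y ^ 2 - Q ^ 2 = (Y - Q) * (Y + Q) := by ring
    rw [this, abs_mul, abs_of_nonneg (show 0 ≤ Y + Q by positivity)]
    refine mul_le_mul hYQ ?_ (by positivity) (by rw [hη]; positivity)
    have := (abs_le.1 hYQ).2
    rw [hη] at this
    nlinarith
  have hP2 : |P ^ 2 - Z ^ 2| ≤ (c * l * r) * (3 * P) := by
    have : P ^ 2 - Z ^ 2 = (P - Z) * (P + Z) := by ring
    rw [this, abs_mul, abs_of_nonneg (show 0 ≤ P + Z by positivity)]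
    refine mul_le_mul hPZ ?_ (by positivity) (by rw [hc]; positivity)
    have := (abs_le.1 hPZ).1
    have h7 : c * l * r ≤ r := by
      have : c * l ≤ 1 := by rw [hc]; nlinarith
      nlinarith
    linarith
  have hZ2 : |Z ^ 2 - Q ^ 2| ≤ l * ((η * r) * (3 * Q)) + M * l * r ^ 2 := by
    have e : Z ^ 2 - Q ^ 2 = (Z ^ 2 - ((1 - l) * Q ^ 2 + l * Y ^ 2)) + l * (Y ^ 2 - Q ^ 2) := by ring
    rw [e]
    refine (abs_add_le _ _).trans ?_
    rw [abs_mul l, abs_of_pos hl0]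
    have h1 : l * |Y ^ 2 - Q ^ 2| ≤ l * ((η * r) * (3 * Q)) := by gcongr
    have h2 : M * l * (1 - l) * r ^ 2 ≤ M * l * r ^ 2 := by
      have : 0 ≤ M * l * l * r ^ 2 := by positivity
      nlinarith
    linarith
  have h2 : |P ^ 2 + b ^ 2 - Q ^ 2| ≤ |P ^ 2 - Z ^ 2| + |Z ^ 2 - Q ^ 2| + b ^ 2 := by
    have : P ^ 2 + b ^ 2 - Q ^ 2 = (P ^ 2 - Z ^ 2) + (Z ^ 2 - Q ^ 2) + b ^ 2 := by ring
    rw [this]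
    exact (abs_add_three _ _ _).trans (by rw [abs_of_nonneg (sq_nonneg b)])
  have h3 : b ^ 2 ≤ (l * r) * (σ * P / 4) := by
    have h8 : b ≤ r / 8 := by nlinarith
    rw [sq]
    calc b * b ≤ (2 * (l * r)) * (r / 8) := by gcongr
      _ = (l * r) * (r / 4) := by ring
      _ ≤ _ := by gcongr; linarith
  have h4 : σ * P * (l * r * (3 / 4)) ≤ σ * P * b := by gcongr
  have h5 : 0 < σ * P * (l * r) := by positivity
  have h6 : M * l * r ^ 2 ≤ (l * r) * (σ * P / 4) := by
    calc M * l * r ^ 2 = (l * r) * (M * r) := by ring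
      _ ≤ _ := by gcongr
  have h7 : l * ((η * r) * (3 * Q)) ≤ (l * r) * (6 * σ / 16 * P) := by
    calc l * ((η * r) * (3 * Q)) = (l * r) * (3 / 16 * (σ * Q)) := by rw [hη]; ring
      _ ≤ (l * r) * (3 / 16 * (σ * (2 * P))) := by gcongr
      _ = _ := by ring
  have h8 : (c * l * r) * (3 * P) = (3 / 16) * (σ * P * (l * r)) := by rw [hc]; ring
  linarith

set_option maxHeartbeats 1000000 in
lemma strained_near {S C D : ℝ} (hS : 1 ≤ S) (hC : 0 ≤ C)
    (hconc : SConcave X S) (hsemi : LocSemiConvex X C D)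
    {k : ℕ} (hk1 : 1 ≤ k) {θ δ : ℝ} (hδθ : δ ≤ θ) (hθ0 : 0 < θ) (hθ : θ < 1 / 2)
    (p : Fin k → X) {σ l : ℝ} (hσ : σ = 1 - Real.cos θ) (hl : l = σ / (16 * S))
    (x y : X) (hxy : x ≠ y)
    (hr1 : ∀ i, 8 * (S + C) * dist x y ≤ σ * dist (p i) x)
    (hr2 : ∀ i, dist (p i) x + dist x y < D)
    (hF : ∀ i, |dist (p i) y - dist (p i) x| ≤ σ / 16 * dist x y)
    (γ : ℝ → X) (hγ : IsConstSpeedGeodesic γ) (hγ0 : γ 0 = x) (hγ1 : γ 1 = y)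
    (w : X) (hw : dist w (γ l) ≤ σ / 16 * (l * dist x y))
    (q : Fin k → X) (hq : IsStrainer S C D δ w p q) :
    w ∈ strainedPoints X S C D θ (k + 1) := by
  have hpi := Real.pi_gt_three
  have hcos : 0 < Real.cos θ := Real.cos_pos_of_mem_Ioo ⟨by linarith, by linarith⟩
  have hσ1 : σ < 1 := by linarith
  have hσ0 : 0 < σ := by
    have : Real.cos θ < Real.cos 0 := Real.cos_lt_cos_of_nonneg_of_le_pi le_rfl (by linarith) hθ0
    rw [Real.cos_zero] at this
    linarith
  set r := dist x y with hr
  have hr0 : 0 < r := dist_pos.2 hxy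
  have hl0 : 0 < l := by rw [hl]; positivity
  have hSl : S * l = σ / 16 := by rw [hl]; field_simp
  have hl1 : l ≤ σ / 16 := by nlinarith
  have hl2 : l ≤ 1 / 16 := by linarith
  have hlmem : l ∈ Set.Icc (0:ℝ) 1 := ⟨hl0.le, by linarith⟩
  set z := γ l with hz
  have hxz : dist x z = l * r := by
    have := hγ 0 (by simp) l hlmem
    rw [hγ0, hγ1] at this
    rw [hz, this, zero_sub, abs_neg, abs_of_pos hl0]
  have hzy : dist z y = (1 - l) * r := by
    have := hγ l hlmem 1 (by simp)
    rw [hγ0, hγ1] at this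
    rw [hz, this, abs_sub_comm, abs_of_nonneg (by linarith)]
  set c := σ / 16 with hc
  have hlr : 0 < l * r := by positivity
  have hclr : c * (l * r) = c * l * r := by ring
  rw [hclr] at hw
  have hclr2 : c * l * r ≤ l * r / 16 := by nlinarith
  have hclr0 : 0 < c * l * r := by positivity
  have hlr2 : l * r ≤ r / 16 := by nlinarith
  have ha1 : (1 - l) * r - c * l * r ≤ dist w y := by
    have := dist_triangle_left z y w
    linarith
  have ha2 : dist w y ≤ (1 - l) * r + c * l * r := by
    have := dist_triangle w z y
    linarith
  have hb1 : l * r - c * l * r ≤ dist w x := by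
    have := dist_triangle_left x z w
    linarith
  have hb2 : dist w x ≤ l * r + c * l * r := by
    have := dist_triangle_right w x z
    linarith
  have ha3 : r / 2 ≤ dist w y := by linarith
  have ha4 : dist w y ≤ 2 * r := by linarith
  have hb3 : l * r * (3 / 4) ≤ dist w x := by linarith
  have hb4 : dist w x ≤ 2 * (l * r) := by linarith
  have hwy : 0 < dist w y := by linarith
  have hwx : 0 < dist w x := by linarith
  -- distances to the strainers
  have hPQ : ∀ i, |dist (p i) w - dist (p i) x| ≤ dist w x := fun i => by
    rw [dist_comm (p i) w, dist_comm (p i) x]; exact abs_dist_sub_le w x (p i)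
  have hM : 1 ≤ S + C := by linarith
  have hMr : r ≤ (S + C) * r := by nlinarith
  have hQ0 : ∀ i, 0 < dist (p i) x := fun i => by
    have := hr1 i
    have : 0 < σ * dist (p i) x := by linarith
    exact pos_of_mul_pos_right this hσ0.le
  have hrQ : ∀ i, 8 * r ≤ dist (p i) x := fun i => by
    have := hr1 i
    have := hQ0 i
    nlinarith
  have hQP : ∀ i, dist (p i) x ≤ 2 * dist (p i) w := fun i => by
    have := (abs_le.1 (hPQ i)).1
    have := hrQ i
    linarith
  have hP0 : ∀ i, 0 < dist (p i) w := fun i => by linarith [hQP i, hQ0 i]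
  have hMrP : ∀ i, (S + C) * r ≤ σ * dist (p i) w / 4 := fun i => by
    have := hr1 i
    have : σ * dist (p i) x ≤ σ * (2 * dist (p i) w) := by gcongr; exact hQP i
    linarith
  obtain ⟨hq1, hq2, hq3⟩ := hq
  refine ⟨Fin.snoc p y, Fin.snoc q x, ?_, ?_, ?_⟩
  · intro j
    refine Fin.lastCases ?_ (fun j => ?_) j
    · simp only [Fin.snoc_last]
      refine ⟨fun h => by rw [h, dist_self] at hwy; exact lt_irrefl _ hwy,
        fun h => by rw [h, dist_self] at hwx; exact lt_irrefl _ hwx, ?_, ?_⟩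
      · apply lt_arccos_of_lt hθ0 hθ
        rw [← hσ, dist_comm y x]
        exact num_A hσ0 hσ1 hl0 hl2 hc hr0 ha1 ha2 hb1 hb2
      · apply arccos_one_sub_lt hθ0 hθ
        rw [← hσ, dist_comm x w, dist_comm y w, div_lt_iff₀ (by positivity)]
        have h1 : S * dist w x ≤ S * (2 * (l * r)) := by gcongr
        have h2 : S * (2 * (l * r)) = σ / 8 * r := by
          calc S * (2 * (l * r)) = 2 * (S * l) * r := by ring
            _ = _ := by rw [hSl]; ring
        have h3 : σ * (r / 2) ≤ σ * dist w y := by gcongr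
        have h4 : 0 < σ * r := by positivity
        linarith
    · simp only [Fin.snoc_castSucc]
      obtain ⟨h1, h2, h3, h4⟩ := hq1 j
      exact ⟨h1, h2, by linarith, by linarith⟩
  · intro j
    refine Fin.lastCases ?_ (fun j => ?_) j
    · intro h; simp at h; omega
    · intro h
      simp only [Fin.snoc_castSucc]
      exact hq2 j (by simpa using h)
  · intro i j
    refine Fin.lastCases ?_ (fun j => ?_) j
    · refine Fin.lastCases (fun h => absurd h (lt_irrefl _)) (fun i _ => ?_) i
      simp only [Fin.snoc_last, Fin.snoc_castSucc]
      refine ⟨?_, ?_, ?_⟩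
      · apply arccos_one_sub_lt hθ0 hθ
        have := hP0 i
        rw [← hσ, dist_comm y w, div_lt_iff₀ (by positivity)]
        have h1 : (S + C) * dist w y ≤ (S + C) * (2 * r) := by gcongr
        have h2 := hMrP i
        have h3 : 0 < σ * dist (p i) w := by positivity
        linarith
      · apply abs_arccos_sub_lt hθ0 hθ
        rw [← hσ, dist_comm w (p i)]
        refine num_D (l := l) (η := c) hσ0 hσ1 hl0 hl1 rfl hr0 (hMr.trans (hMrP i)) ha3 ha4 (hP0 i)
          dist_nonneg ?_
        have h1 := abs_sub_le (dist (p i) w) (dist (p i) x) (dist (p i) y)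
        have h2 := hF i
        rw [abs_sub_comm] at h2
        have h3 := hPQ i
        linarith
      · apply abs_arccos_sub_lt hθ0 hθ
        rw [← hσ, dist_comm w (p i)]
        refine num_E (l := l) (η := c) (c := c) (M := S + C) (r := r) (Y := dist (p i) y)
          (Z := dist (p i) z) hσ0 hσ1 hl0 hl1 rfl rfl hr0 hM (hr1 i) (hQP i) hb3 hb4 dist_nonneg
          dist_nonneg (hF i) ?_ ?_
        · rw [dist_comm (p i) w, dist_comm (p i) z]
          exact (abs_dist_sub_le w z (p i)).trans hw
        · have h1 := hconc (p i) γ hγ l hlmem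
          have h2 := hsemi (p i) γ hγ (fun t ht => by
            have h3 := dist_triangle (p i) x (γ t)
            have h4 := hγ 0 (by simp) t ht
            rw [hγ0, hγ1, zero_sub, abs_neg, abs_of_nonneg ht.1] at h4
            have h5 := hr2 i
            have : t * dist x y ≤ r := by
              have := ht.2
              nlinarith
            linarith) l hlmem
          rw [hγ0, hγ1, ← hz] at h1 h2
          have h3 : 0 ≤ l * (1 - l) * r ^ 2 := by
            have : 0 ≤ 1 - l := by linarith
            positivity
          have h4 : 0 ≤ C * (l * (1 - l) * r ^ 2) := by positivity
          have h5 : 0 ≤ S * (l * (1 - l) * r ^ 2) := by positivity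
          rw [abs_le]
          constructor <;> linarith
    · refine Fin.lastCases (fun h => ?_) (fun i h => ?_) i
      · exact absurd h (not_lt.2 (Fin.le_last _))
      · simp only [Fin.snoc_castSucc]
        obtain ⟨h1, h2, h3⟩ := hq3 i j (by simpa using h)
        exact ⟨by linarith, by linarith, by linarith⟩

/-- on the domain of a `(k,δ)`-strainer map with `k ≤ n-1`, the
set of points admitting no `(k+1,4δ)`-strainer is `μH[n]`-null. -/
theorem stmt_19 {X : Type*} [MetricSpace X] [CompleteSpace X]
    [MeasurableSpace X] [BorelSpace X]
    (S C D : ℝ) (hS : 1 ≤ S) (hC : 0 ≤ C) (hD : 0 < D)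
    (hgeo : IsGeodesicSpace X) (hconc : SConcave X S)
    (hsemi : LocSemiConvex X C D) (hbus : BusemannConcave X)
    (n : ℕ) (hdim : dimH (Set.univ : Set X) = n)
    (k : ℕ) (hk1 : 1 ≤ k) (hkn : k + 1 ≤ n)
    (δ : ℝ) (hδ0 : 0 < δ) (hδ : δ < strainerDelta k) (hδ4 : 4 * δ < 1 / 2)
    (U : Set X) (hU : IsOpen U) (p : Fin k → X)
    (hstr : ∀ x ∈ U, ∃ q : Fin k → X, IsStrainer S C D δ x p q) :
    μH[(n : ℝ)] (U \ strainedPoints X S C D (4 * δ) (k + 1)) = 0 := by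
  have hk0 : 0 < k := hk1
  have hpi := Real.pi_gt_three
  have hsc := secondCountable_of_net hgeo hbus n hdim
  have hdbl : IsUnifLocDoublingMeasure (μH[(n : ℝ)] : Measure X) := doubling_hausdorff hgeo hbus n
  have hfin : IsLocallyFiniteMeasure (μH[(n : ℝ)] : Measure X) :=
    ⟨fun x => ⟨closedBall x 1, closedBall_mem_nhds x one_pos,
      hausdorff_closedBall_lt_top hgeo hbus n hdim x 1 one_pos⟩⟩
  obtain ⟨σ, hσ⟩ : ∃ σ, σ = 1 - Real.cos (4 * δ) := ⟨_, rfl⟩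
  have hσ0 : 0 < σ := by
    have : Real.cos (4 * δ) < Real.cos 0 :=
      Real.cos_lt_cos_of_nonneg_of_le_pi le_rfl (by linarith) (by linarith)
    rw [Real.cos_zero] at this
    linarith
  have hσ1 : σ < 1 := by
    have : 0 < Real.cos (4 * δ) := Real.cos_pos_of_mem_Ioo ⟨by linarith, by linarith⟩
    linarith
  obtain ⟨l, hl⟩ : ∃ l, l = σ / (16 * S) := ⟨_, rfl⟩
  have hl0 : 0 < l := by rw [hl]; positivity
  have hl1 : l ≤ 1 / 16 := by
    rw [hl, div_le_iff₀ (by positivity)]; linarith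
  have hbad := bad_null k n hkn (fun (x : X) i => dist (p i) x) (σ / 16) (by positivity)
  set Bad := {x : X | ∃ m : ℕ, ∀ y, dist x y < 1 / (m + 1) →
    σ / 16 * dist x y ≤ dist (fun i => dist (p i) x) (fun i => dist (p i) y)} with hBad
  set E := U \ strainedPoints X S C D (4 * δ) (k + 1) with hE
  have hG : μH[(n : ℝ)] (E \ Bad) = 0 := by
    refine porous_null _ E (E \ Bad) diff_subset (σ / 16) (by positivity) ?_
    rintro x ⟨⟨hxU, hxs⟩, hxB⟩ e he
    obtain ⟨q, hq1, hq2, hq3⟩ := hstr x hxU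
    have hQ0 : ∀ i, 0 < dist (p i) x := fun i => dist_pos.2 (hq1 i).1
    have hQD : ∀ i, dist (p i) x < D := by
      intro i
      have h0 := hq2 ⟨0, hk0⟩ rfl
      by_cases hi : (i : ℕ) = 0
      · exact hq2 i hi
      have h1 := (hq3 ⟨0, hk0⟩ i (by rw [Fin.lt_def]; simp only; omega)).1
      by_contra hcon
      have h2 : dist (p ⟨0, hk0⟩) x ≤ dist (p i) x := by linarith
      have h3 : 1 / 2 ≤ (S + C) * dist (p i) x / (2 * dist (p ⟨0, hk0⟩) x) := by
        have := hQ0 ⟨0, hk0⟩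
        rw [le_div_iff₀ (by positivity)]
        nlinarith [hQ0 i]
      have h4 : Real.arccos (1 / 2) ≤
          Real.arccos (1 - (S + C) * dist (p i) x / (2 * dist (p ⟨0, hk0⟩) x)) :=
        Real.arccos_le_arccos (by linarith)
      have h5 : Real.arccos (1 / 2) = Real.pi / 3 := by
        rw [← Real.cos_pi_div_three, Real.arccos_cos (by positivity) (by linarith)]
      linarith
    obtain ⟨R, hR0, hRU⟩ := Metric.isOpen_iff.1 hU x hxU
    have hev : ∀ᶠ ρ in 𝓝[>] (0:ℝ), 0 < ρ ∧ ρ < e ∧ ρ < R ∧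
        ∀ i, 8 * (S + C) * ρ < σ * dist (p i) x ∧ dist (p i) x + ρ < D := by
      refine Filter.Eventually.and self_mem_nhdsWithin (Filter.Eventually.filter_mono nhdsWithin_le_nhds ?_)
      refine (eventually_lt_nhds he).and ((eventually_lt_nhds hR0).and (eventually_all.2 fun i => ?_))
      refine Filter.Eventually.and ?_ ?_
      · refine Tendsto.eventually_lt_const (v := 0) (by have := hQ0 i; positivity) ?_
        exact Continuous.tendsto' (by fun_prop) _ _ (by simp)
      · refine Tendsto.eventually_lt_const (v := dist (p i) x) (hQD i) ?_
        exact Continuous.tendsto' (by fun_prop) _ _ (by simp)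
    obtain ⟨ρ, hρ0, hρe, hρR, hρ⟩ := hev.exists
    obtain ⟨m, hm⟩ := exists_nat_one_div_lt hρ0
    simp only [hBad, mem_ofPred_eq, not_exists, not_forall, not_le] at hxB
    obtain ⟨y, hy1, hy2⟩ := hxB m
    have hr0 : 0 < dist x y := by
      have : 0 < σ / 16 * dist x y := lt_of_le_of_lt dist_nonneg hy2
      exact pos_of_mul_pos_right this (by positivity)
    have hrρ : dist x y < ρ := hy1.trans hm
    obtain ⟨γ, hγ, hγ0, hγ1⟩ := hgeo x y
    have hxz : dist x (γ l) = l * dist x y := by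
      have := hγ 0 (by simp) l ⟨hl0.le, by linarith⟩
      rw [hγ0, hγ1] at this
      rw [this, zero_sub, abs_neg, abs_of_pos hl0]
    refine ⟨l * dist x y, γ l, by positivity, by nlinarith, hxz.le, ?_⟩
    rw [Set.disjoint_left]
    rintro w ⟨hwU, hws⟩ hw
    obtain ⟨q', hq'⟩ := hstr w hwU
    refine hws (strained_near hS hC hconc hsemi hk1 (δ := δ) (by linarith) (by linarith) hδ4 p hσ hl x y
      (dist_pos.1 hr0) (fun i => ?_) (fun i => ?_) (fun i => ?_) γ hγ hγ0 hγ1 w hw q' hq')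
    · have : 8 * (S + C) * dist x y ≤ 8 * (S + C) * ρ := by gcongr
      linarith [(hρ i).1]
    · linarith [(hρ i).2]
    · have := dist_le_pi_dist (fun i => dist (p i) x) (fun i => dist (p i) y) i
      rw [Real.dist_eq, abs_sub_comm] at this
      linarith
  refine measure_mono_null (t := (E \ Bad) ∪ Bad) (fun x hx => ?_) (measure_union_null hG hbad)
  by_cases h : x ∈ Bad
  · exact Or.inr h
  · exact Or.inl ⟨hx, h⟩
end
end
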